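/- Let f be transcendental meromorphic on ℂ with finitely many poles. Then the equation ż = f(z) has infinitely many pairwise disjoint trajectories, each tending to infinity in finite increasing time. -/

import Mathlib

section

open Complex Set Filter Topology Metric

/-- An entire function of polynomial growth is a polynomial. -/
theorem exists_polynomial_of_growth {h : ℂ → ℂ} (hh : Differentiable ℂ h) {R D : ℝ} {m : ℕ}
    (hR : 0 < R) (hb : ∀ z, R ≤ ‖z‖ → ‖h z‖ ≤ D * ‖z‖ ^ m) :
    ∃ p : Polynomial ℂ, ∀ z, h z = p.eval z := by
  have hder : ∀ n, m < n → iteratedDeriv n h 0 = 0 := by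
    intro n hn
    have h1 : ∀ᶠ r : ℝ in atTop, ‖iteratedDeriv n h 0‖ ≤ n.factorial * D * (r ^ m / r ^ n) := by
      filter_upwards [eventually_ge_atTop R] with r hr
      have hr0 : 0 < r := hR.trans_le hr
      refine (Complex.norm_iteratedDeriv_le_of_forall_mem_sphere_norm_le (c := 0) n hr0
        hh.diffContOnCl (C := D * r ^ m) (fun z hz => ?_)).trans_eq (by ring)
      have hz' : ‖z‖ = r := by simpa using hz
      rw [← hz']; exact hb z (hz' ▸ hr)
    have h2 : Tendsto (fun r : ℝ => (n.factorial * D) * (r ^ m / r ^ n)) atTop (𝓝 0) := by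
      simpa using (tendsto_pow_div_pow_atTop_zero (𝕜 := ℝ) hn).const_mul (n.factorial * D)
    simpa using le_antisymm (ge_of_tendsto h2 h1) (norm_nonneg _)
  refine ⟨∑ i ∈ Finset.range (m + 1),
    Polynomial.C ((i.factorial : ℂ)⁻¹ * iteratedDeriv i h 0) * Polynomial.X ^ i, fun z => ?_⟩
  have hs := Complex.hasSum_taylorSeries_of_entire hh 0 z
  rw [← hs.tsum_eq, tsum_eq_sum (s := Finset.range (m + 1))]
  · rw [Polynomial.eval_finsetSum]
    refine Finset.sum_congr rfl fun i _ => ?_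
    simp; ring
  · intro i hi
    rw [hder i (by simpa [Nat.lt_succ_iff] using hi)]
    simp

/-- Exceptional growth of transcendental functions with finitely many poles. -/
theorem exists_large_of_transcendental {f : ℂ → ℂ} (hf : MeromorphicOn f Set.univ)
    (hpoles : {w : ℂ | ¬ AnalyticAt ℂ f w}.Finite)
    (htrans : ¬ ∃ p q : Polynomial ℂ, q ≠ 0 ∧
      ∀ w : ℂ, AnalyticAt ℂ f w → f w * q.eval w = p.eval w) (R D : ℝ) (m : ℕ) (hR : 0 < R) :
    ∃ z, R ≤ ‖z‖ ∧ D * ‖z‖ ^ m < ‖f z‖ := by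
  by_contra! hcon
  apply htrans
  choose n hn using fun x => hf x (mem_univ x)
  let q : Polynomial ℂ := ∏ p ∈ hpoles.toFinset, (Polynomial.X - Polynomial.C p) ^ n p
  have hq : ∀ w, q.eval w = ∏ p ∈ hpoles.toFinset, (w - p) ^ n p := by
    intro w; simp [q, Polynomial.eval_prod]
  have hq0 : q ≠ 0 := by
    refine Finset.prod_ne_zero_iff.2 fun p _ => pow_ne_zero _ (Polynomial.X_sub_C_ne_zero p)
  have han : Differentiable ℂ fun w => f w * q.eval w := by
    intro w
    by_cases hw : AnalyticAt ℂ f w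
    · exact hw.differentiableAt.mul (Polynomial.differentiable q w)
    · have hmem : w ∈ hpoles.toFinset := by simpa using hw
      have : (fun z => f z * q.eval z) = fun z => ((z - w) ^ n w • f z) *
          ∏ p ∈ hpoles.toFinset.erase w, (z - p) ^ n p := by
        ext z
        rw [hq, ← Finset.mul_prod_erase _ _ hmem]
        simp only [smul_eq_mul]; ring
      rw [this]
      refine (hn w).differentiableAt.mul ?_
      fun_prop
  obtain ⟨C, hC⟩ : ∃ C, ∀ z, R ≤ ‖z‖ → ‖q.eval z‖ ≤ C * ‖z‖ ^ q.natDegree := by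
    refine ⟨∑ i ∈ Finset.range (q.natDegree + 1), ‖q.coeff i‖ * (R⁻¹) ^ (q.natDegree - i), ?_⟩
    intro z hz
    rw [Polynomial.eval_eq_sum_range, Finset.sum_mul]
    refine (norm_sum_le _ _).trans (Finset.sum_le_sum fun i hi => ?_)
    rw [norm_mul, norm_pow, mul_assoc]
    gcongr
    have hi' : i ≤ q.natDegree := by simpa [Nat.lt_succ_iff] using hi
    have : ‖z‖ ^ q.natDegree = ‖z‖ ^ (q.natDegree - i) * ‖z‖ ^ i := by
      rw [← pow_add]; congr 1; omega
    rw [this, ← mul_assoc, ← mul_pow]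
    refine le_mul_of_one_le_left (by positivity) (one_le_pow₀ ?_)
    rw [inv_mul_eq_div, one_le_div hR]; exact hz
  have hgrowth : ∀ z, R ≤ ‖z‖ → ‖f z * q.eval z‖ ≤ (D * C) * ‖z‖ ^ (m + q.natDegree) := by
    intro z hz
    rw [norm_mul, pow_add]
    calc _ ≤ (D * ‖z‖ ^ m) * (C * ‖z‖ ^ q.natDegree) :=
          mul_le_mul (hcon z hz) (hC z hz) (norm_nonneg _) ((norm_nonneg _).trans (hcon z hz))
      _ = _ := by ring
  obtain ⟨p, hp⟩ := exists_polynomial_of_growth han hR hgrowth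
  exact ⟨p, q, hq0, fun w _ => hp w⟩

theorem one_le_one_sub_mul_exp {x : ℝ} (hx : x ≤ 1 / 2) :
    1 ≤ (1 - x) * Real.exp (x + 2 * x ^ 2) := by
  have h := Real.add_one_le_exp (x + 2 * x ^ 2)
  nlinarith [mul_le_mul_of_nonneg_left h (by linarith : (0 : ℝ) ≤ 1 - x),
    mul_nonneg (sq_nonneg x) (by linarith : (0 : ℝ) ≤ 1 - 2 * x)]

/-- A function of fast growth has points of arbitrarily large modulus around which it is dominated,
in logarithmic coordinates, by an exponential of large rate `N`. -/
theorem exists_point_dominated {f : ℂ → ℂ} {R : ℝ} (hR : 1 ≤ R)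
    (hf : ContinuousOn f {z | R ≤ ‖z‖})
    (hlarge : ∀ (D : ℝ) (m : ℕ), ∃ z, R ≤ ‖z‖ ∧ D * ‖z‖ ^ m < ‖f z‖)
    (n A : ℕ) (hn : 0 < n) (hA : 0 < A) (B : ℝ) :
    ∃ (z₀ : ℂ) (N : ℝ), R < ‖z₀‖ ∧ B < ‖f z₀ / z₀‖ ∧ n ≤ N ∧
      ∀ s : ℂ, ‖s‖ ≤ n → ‖s‖ ≤ A / 2 → R < ‖z₀ * exp (s / N)‖ ∧
        ‖f (z₀ * exp (s / N)) / (z₀ * exp (s / N))‖ ≤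
          ‖f z₀ / z₀‖ * Real.exp (s.re + 2 * ‖s‖ ^ 2 / A) := by
  have hR0 : 0 < R := by linarith
  have hgc : ContinuousOn (fun z => ‖f z / z‖) {z | R ≤ ‖z‖} := by
    refine (hf.div continuousOn_id fun z hz => ?_).norm
    exact norm_pos_iff.1 (hR0.trans_le hz)
  obtain ⟨M, hM⟩ : ∃ M, ∀ z : ℂ, R ≤ ‖z‖ → ‖z‖ ≤ R * Real.exp 1 → ‖f z / z‖ ≤ M := by
    have hc : IsCompact ({z : ℂ | R ≤ ‖z‖} ∩ closedBall 0 (R * Real.exp 1)) :=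
      (isCompact_closedBall _ _).inter_left (isClosed_le continuous_const continuous_norm)
    obtain ⟨M, hM⟩ := hc.bddAbove_image (hgc.mono inter_subset_left)
    exact ⟨M, fun z h1 h2 => hM ⟨z, ⟨h1, by simpa using h2⟩, rfl⟩⟩
  set D := max (max M B) 0 with hD
  obtain ⟨z₁, hz₁, hz₁'⟩ := hlarge D (n + A + 1)
  have hz₁0 : 0 < ‖z₁‖ := hR0.trans_le hz₁
  have hlogz₁ : Real.log R ≤ Real.log ‖z₁‖ := Real.log_le_log hR0 hz₁
  have hlogR : 0 ≤ Real.log R := Real.log_nonneg hR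
  set b := Real.log ‖z₁‖ + 1 with hb
  have hz₁b : Real.log ‖z₁‖ < b := by linarith
  let G : ℂ → ℝ := fun z => ‖f z / z‖ * (‖z‖ ^ n)⁻¹ * (b - Real.log ‖z‖) ^ A
  have hK : IsCompact ({z : ℂ | R ≤ ‖z‖} ∩ closedBall 0 (Real.exp b)) :=
    (isCompact_closedBall _ _).inter_left (isClosed_le continuous_const continuous_norm)
  have hmemK : ∀ z : ℂ, R ≤ ‖z‖ → Real.log ‖z‖ ≤ b →
      z ∈ {z : ℂ | R ≤ ‖z‖} ∩ closedBall 0 (Real.exp b) := by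
    intro z h1 h2
    refine ⟨h1, ?_⟩
    simpa using (Real.log_le_iff_le_exp (hR0.trans_le h1)).1 h2
  have hGc : ContinuousOn G ({z : ℂ | R ≤ ‖z‖} ∩ closedBall 0 (Real.exp b)) := by
    have hne : ∀ z ∈ {z : ℂ | R ≤ ‖z‖} ∩ closedBall 0 (Real.exp b), ‖z‖ ≠ 0 :=
      fun z hz => (hR0.trans_le hz.1).ne'
    refine ((hgc.mono inter_subset_left).mul (ContinuousOn.inv₀ (by fun_prop) ?_)).mul
      ((continuousOn_const.sub (ContinuousOn.log (by fun_prop) hne)).pow A)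
    exact fun z hz => pow_ne_zero _ (hne z hz)
  obtain ⟨z₀, hz₀K, hmax⟩ := hK.exists_isMaxOn ⟨z₁, hmemK z₁ hz₁ hz₁b.le⟩ hGc
  have hz₀R : R ≤ ‖z₀‖ := hz₀K.1
  have hz₀0 : 0 < ‖z₀‖ := hR0.trans_le hz₀R
  have hz₀b : Real.log ‖z₀‖ ≤ b := by
    refine (Real.log_le_iff_le_exp hz₀0).2 ?_
    simpa using hz₀K.2
  have hD0 : 0 ≤ D := le_max_right _ _
  have hle₁ : D * ‖z₁‖ ^ A < G z₀ := by
    refine lt_of_lt_of_le ?_ (hmax (hmemK z₁ hz₁ hz₁b.le))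
    have : b - Real.log ‖z₁‖ = 1 := by rw [hb]; ring
    simp only [G, this, one_pow, mul_one, norm_div]
    rw [← div_eq_mul_inv, lt_div_iff₀ (by positivity), lt_div_iff₀ hz₁0]
    exact lt_of_eq_of_lt (by ring) hz₁'
  have hbig : D < ‖f z₀ / z₀‖ := by
    have h1 : G z₀ ≤ ‖f z₀ / z₀‖ * ‖z₁‖ ^ A := by
      refine mul_le_mul (mul_le_of_le_one_right (norm_nonneg _) ?_) ?_ (by
        exact pow_nonneg (by linarith) _) (norm_nonneg _)
      · exact inv_le_one_of_one_le₀ (one_le_pow₀ (hR.trans hz₀R))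
      · refine pow_le_pow_left₀ (by linarith) ?_ _
        have := Real.log_nonneg (hR.trans hz₀R)
        have := Real.log_le_sub_one_of_pos hz₁0
        linarith
    exact lt_of_mul_lt_mul_right (hle₁.trans_le h1) (by positivity)
  have hz₀e : R * Real.exp 1 < ‖z₀‖ := by
    by_contra! h
    exact (hbig.trans_le (hM z₀ hz₀R h)).not_ge ((le_max_left _ _).trans (le_max_left _ _))
  have hz₀b' : Real.log ‖z₀‖ < b := by
    refine lt_of_le_of_ne hz₀b fun h => ?_
    have : G z₀ = 0 := by simp [G, h, hA.ne']
    rw [this] at hle₁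
    exact hle₁.not_ge (by positivity)
  set d := b - Real.log ‖z₀‖ with hd
  have hd0 : 0 < d := by linarith
  have hA' : (0 : ℝ) < A := by exact_mod_cast hA
  have hn' : (0 : ℝ) < n := by exact_mod_cast hn
  refine ⟨z₀, n + A / d, ?_, ((le_max_right _ _).trans (le_max_left _ _)).trans_lt hbig,
    by linarith [div_pos hA' hd0], fun s hsn hsA => ?_⟩
  · refine lt_of_le_of_lt ?_ hz₀e
    exact le_mul_of_one_le_right hR0.le (Real.one_le_exp zero_le_one)
  set N := n + A / d with hN
  have hNn : n ≤ N := by linarith [div_pos hA' hd0]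
  have hNd : A / d ≤ N := by linarith
  have hN0 : 0 < N := by linarith [div_pos hA' hd0]
  have hnorm : ‖z₀ * exp (s / N)‖ = ‖z₀‖ * Real.exp (s.re / N) := by
    rw [norm_mul, norm_exp, div_ofReal_re]
  have hre : |s.re| ≤ ‖s‖ := abs_re_le_norm s
  have h1 : -1 ≤ s.re / N := by
    rw [le_div_iff₀ hN0]; linarith [neg_abs_le s.re]
  set x := s.re / N / d with hx
  have hxabs : |x| ≤ ‖s‖ / A := by
    have : A ≤ N * d := by rwa [div_le_iff₀ hd0] at hNd
    rw [hx, abs_div, abs_div, abs_of_pos hN0, abs_of_pos hd0, div_div]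
    gcongr
  have hx2 : x ≤ 1 / 2 := by
    refine (le_abs_self x).trans (hxabs.trans ?_)
    rw [div_le_iff₀ hA']; linarith
  have hgt : R < ‖z₀ * exp (s / N)‖ := by
    rw [hnorm]
    calc R = R * Real.exp 1 * Real.exp (-1) := by rw [mul_assoc, ← Real.exp_add]; simp
      _ < ‖z₀‖ * Real.exp (-1) := by gcongr
      _ ≤ _ := by gcongr
  refine ⟨hgt, ?_⟩
  have hlogz : Real.log ‖z₀ * exp (s / N)‖ = Real.log ‖z₀‖ + s.re / N := by
    rw [hnorm, Real.log_mul hz₀0.ne' (Real.exp_pos _).ne', Real.log_exp]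
  have hsx : s.re / N = x * d := by rw [hx]; field_simp
  have hle := hmax (hmemK _ hgt.le (by rw [hlogz, hsx]; nlinarith))
  have hbz : b - Real.log ‖z₀ * exp (s / N)‖ = d * (1 - x) := by rw [hlogz, hsx, hd]; ring
  have hpow : ‖z₀ * exp (s / N)‖ ^ n = ‖z₀‖ ^ n * Real.exp (n * (s.re / N)) := by
    rw [hnorm, mul_pow, ← Real.exp_nat_mul]
  simp only [mem_ofPred_eq, G, hbz, hpow, ← hd, mul_pow, mul_inv, ← Real.exp_neg] at hle
  set u := ‖f (z₀ * exp (s / N)) / (z₀ * exp (s / N))‖ with hu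
  have hle' : u * (1 - x) ^ A ≤ ‖f z₀ / z₀‖ * Real.exp (n * (s.re / N)) := by
    have hpos : 0 < (‖z₀‖ ^ n)⁻¹ * d ^ A * Real.exp (-(n * (s.re / N))) := by positivity
    refine le_of_mul_le_mul_right (le_of_eq_of_le ?_ (hle.trans_eq ?_)) hpos
    · ring
    · rw [Real.exp_neg]; field_simp
  calc u ≤ u * ((1 - x) * Real.exp (x + 2 * x ^ 2)) ^ A :=
        le_mul_of_one_le_right (norm_nonneg _) (one_le_pow₀ (one_le_one_sub_mul_exp hx2))
    _ = u * (1 - x) ^ A * Real.exp (A * (x + 2 * x ^ 2)) := by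
        rw [mul_pow, ← Real.exp_nat_mul]; ring
    _ ≤ ‖f z₀ / z₀‖ * Real.exp (n * (s.re / N)) * Real.exp (A * (x + 2 * x ^ 2)) := by gcongr
    _ = ‖f z₀ / z₀‖ * Real.exp (s.re + 2 * A * x ^ 2) := by
        rw [mul_assoc, ← Real.exp_add]
        congr 2
        have : s.re = s.re / N * (n + A / d) := by rw [← hN]; field_simp
        conv_rhs => rw [this]
        rw [hx]; field_simp; ring
    _ ≤ _ := by
        gcongr
        have : x ^ 2 ≤ (‖s‖ / A) ^ 2 := sq_le_sq' (by linarith [neg_abs_le x]) ((le_abs_self x).trans hxabs)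
        calc 2 * A * x ^ 2 ≤ 2 * A * (‖s‖ / A) ^ 2 := by gcongr
          _ = _ := by field_simp
theorem norm_sub_one_le_of_norm_le {k : ℂ → ℂ} {ρ η : ℝ} (hρ : 0 < ρ) (hη : 0 < η)
    (hk : DifferentiableOn ℂ k (ball 0 (2 * ρ))) (hk0 : k 0 = 1)
    (hle : ∀ s ∈ ball (0 : ℂ) (2 * ρ), ‖k s‖ ≤ 1 + η) :
    ∀ s ∈ ball (0 : ℂ) ρ, ‖k s - 1‖ ≤ 2 * η := by
  intro s hs
  have hs' : ‖s‖ < ρ := by simpa using hs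
  have h := Complex.borelCaratheodory_zero (f := fun s => k s - 1) (R := 2 * ρ) (z := s) hη
    (hk.sub_const 1) (fun z hz => ?_) (by positivity) (by simp; linarith) (by simp [hk0])
  · refine h.trans ?_
    rw [div_le_iff₀ (by linarith)]
    gcongr; linarith
  · have h1 := (re_le_norm (k z)).trans (hle z hz)
    simp only [mem_ofPred_eq, sub_re, one_re]
    linarith

/-- Inversion of a primitive of `exp (-s) / k s` in logarithmic coordinates, for `k` close
to `1`. -/
theorem exists_log_chart (ρ : ℝ) (hρ : 0 < ρ) : ∃ ε > 0, ∀ (k : ℂ → ℂ) (u : ℂ), ‖u‖ = 1 →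
    DifferentiableOn ℂ k (ball 0 ρ) → (∀ s ∈ ball (0 : ℂ) ρ, ‖k s - 1‖ ≤ ε) →
    ∃ S : ℂ → ℂ, ∀ w ∈ ball (0 : ℂ) (ρ / 4 - 4), S w ∈ ball (0 : ℂ) ρ ∧
      HasDerivAt S (u * exp w * exp (S w) * k (S w)) w ∧
      ∀ w' ∈ ball (0 : ℂ) (ρ / 4 - 4), S w = S w' → w = w' := by
  set P := ρ * Real.exp (2 * ρ) + 1 with hP
  have hP1 : 1 ≤ P := by have : 0 ≤ ρ * Real.exp (2 * ρ) := by positivity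
                         linarith
  refine ⟨1 / (16 * P), by positivity, fun k u hu hk hk1 => ?_⟩
  set ε := 1 / (16 * P) with hε
  have hε0 : 0 < ε := by positivity
  have hεP : ε * P = 1 / 16 := by rw [hε]; field_simp
  have hε1 : ε ≤ 1 / 16 := by nlinarith
  have hu0 : u ≠ 0 := by rintro rfl; simp at hu
  have hkne : ∀ s ∈ ball (0 : ℂ) ρ, 1 / 2 ≤ ‖k s‖ := by
    intro s hs
    have h1 := hk1 s hs
    have h2 : ‖(1 : ℂ)‖ - ‖k s‖ ≤ ‖k s - 1‖ := by rw [norm_sub_rev]; exact norm_sub_norm_le _ _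
    rw [norm_one] at h2
    linarith
  have hk0 : ∀ s ∈ ball (0 : ℂ) ρ, k s ≠ 0 := fun s hs h => by
    have := hkne s hs
    rw [h, norm_zero] at this
    norm_num at this
  have hkinv : ∀ s ∈ ball (0 : ℂ) ρ, ‖(k s)⁻¹ - 1‖ ≤ 2 * ε := by
    intro s hs
    have : (k s)⁻¹ - 1 = (1 - k s) / k s := by field_simp [hk0 s hs]
    rw [this, norm_div, div_le_iff₀ (by linarith [hkne s hs]), norm_sub_rev]
    nlinarith [hk1 s hs, hkne s hs]
  obtain ⟨E, hE0, hE⟩ : ∃ E : ℂ → ℂ, E 0 = -1 ∧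
      ∀ s ∈ ball (0 : ℂ) ρ, HasDerivAt E (exp (-s) * (k s)⁻¹) s := by
    have hd : DifferentiableOn ℂ (fun s => exp (-s) * (k s)⁻¹) (ball 0 ρ) :=
      DifferentiableOn.mul (by fun_prop) (hk.inv hk0)
    obtain ⟨E, h1, h2⟩ := hd.isExactOn_ball.with_val_at 0 (-1)
    exact ⟨E, h1, h2⟩
  have hnorm : ∀ s ∈ ball (0 : ℂ) ρ, ‖s‖ < ρ := fun s hs => by simpa using hs
  have hp : ∀ s ∈ ball (0 : ℂ) ρ, ‖E s + exp (-s)‖ ≤ 2 * ε * Real.exp ρ * ρ := by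
    intro s hs
    have hd : ∀ s ∈ ball (0 : ℂ) ρ, HasDerivWithinAt (fun s => E s + exp (-s))
        (exp (-s) * ((k s)⁻¹ - 1)) (ball 0 ρ) s := by
      intro s hs
      have := (hE s hs).add ((hasDerivAt_id s).neg.cexp)
      refine (this.congr_deriv ?_).hasDerivWithinAt
      simp; ring
    have := (convex_ball (0 : ℂ) ρ).norm_image_sub_le_of_norm_hasDerivWithin_le hd
      (C := 2 * ε * Real.exp ρ) (fun s hs => ?_) (mem_ball_self hρ) hs
    · simp only [hE0, neg_zero, exp_zero, neg_add_cancel, sub_zero] at this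
      refine this.trans ?_
      gcongr
      exact (hnorm s hs).le
    · rw [norm_mul, norm_exp, mul_comm]
      gcongr
      · exact hkinv s hs
      · exact (re_le_norm _).trans (by simpa using (hnorm s hs).le)
  set q : ℂ → ℂ := fun s => -E s * exp s with hq
  have hq1 : ∀ s ∈ ball (0 : ℂ) ρ, ‖q s - 1‖ ≤ 2 * ε * (ρ * Real.exp (2 * ρ)) := by
    intro s hs
    have : q s - 1 = -((E s + exp (-s)) * exp s) := by
      simp only [hq, add_mul, ← exp_add]; simp; ring
    rw [this, norm_neg, norm_mul, norm_exp]
    calc _ ≤ (2 * ε * Real.exp ρ * ρ) * Real.exp ρ := by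
          gcongr
          · exact hp s hs
          · exact (re_le_norm _).trans (hnorm s hs).le
      _ = _ := by rw [two_mul ρ, Real.exp_add]; ring
  have hqd : ∀ s ∈ ball (0 : ℂ) ρ, HasDerivAt q (q s - (k s)⁻¹) s := by
    intro s hs
    refine ((hE s hs).neg.mul (hasDerivAt_exp s)).congr_deriv ?_
    have : exp (-s) * exp s = 1 := by rw [← exp_add]; simp
    simp only [hq, Pi.neg_apply]
    linear_combination (-(k s)⁻¹) * this
  have hq8 : ∀ s ∈ ball (0 : ℂ) ρ, ‖q s - 1‖ ≤ 1 / 8 := by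
    intro s hs
    nlinarith [hq1 s hs]
  have hq8' : ∀ s ∈ ball (0 : ℂ) ρ, ‖q s - (k s)⁻¹‖ ≤ 1 / 8 := by
    intro s hs
    have : q s - (k s)⁻¹ = (q s - 1) - ((k s)⁻¹ - 1) := by ring
    rw [this]
    refine (norm_sub_le _ _).trans ?_
    nlinarith [hq1 s hs, hkinv s hs]
  have hqn : ∀ s ∈ ball (0 : ℂ) ρ, 1 / 2 ≤ ‖q s‖ := by
    intro s hs
    have h1 := hq8 s hs
    have h2 : ‖(1 : ℂ)‖ - ‖q s‖ ≤ ‖q s - 1‖ := by rw [norm_sub_rev]; exact norm_sub_norm_le _ _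
    rw [norm_one] at h2
    linarith
  have hqslit : ∀ s ∈ ball (0 : ℂ) ρ, q s ∈ slitPlane := by
    intro s hs
    refine mem_slitPlane_of_norm_lt_one (z := q s - 1) (by linarith [hq8 s hs]) |> fun h => ?_
    simpa using h
  set L : ℂ → ℂ := fun s => log (q s) + log (-u⁻¹) with hL
  have hLd : ∀ s ∈ ball (0 : ℂ) ρ, HasDerivAt L ((q s - (k s)⁻¹) / q s) s := fun s hs =>
    ((hqd s hs).clog (hqslit s hs)).add_const _
  have hLlip : LipschitzOnWith (1 / 2) L (ball 0 ρ) := by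
    refine (convex_ball (0 : ℂ) ρ).lipschitzOnWith_of_nnnorm_hasDerivWithin_le
      (fun s hs => (hLd s hs).hasDerivWithinAt) (fun s hs => ?_)
    rw [← NNReal.coe_le_coe]
    simp only [coe_nnnorm, norm_div]
    rw [div_le_iff₀ (by linarith [hqn s hs])]
    have := hq8' s hs
    have := hqn s hs
    norm_num
    linarith
  have hL0 : ‖L 0‖ ≤ 4 := by
    simp only [hL, hq, hE0, neg_neg, exp_zero, mul_one, log_one, zero_add]
    have : log (-u⁻¹) = (arg (-u⁻¹) : ℂ) * I := by
      rw [log]; simp [hu]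
    rw [this, norm_mul, norm_I, mul_one, norm_real, Real.norm_eq_abs]
    exact (abs_arg_le_pi _).trans Real.pi_le_four
  set W : ℂ → ℂ := fun s => -s + L s with hW
  have hWd : ∀ s ∈ ball (0 : ℂ) ρ, HasDerivAt W (-1 + (q s - (k s)⁻¹) / q s) s := fun s hs =>
    ((hasDerivAt_id s).neg).add (hLd s hs)
  have hanti : ∀ s ∈ ball (0 : ℂ) ρ, ∀ s' ∈ ball (0 : ℂ) ρ, ‖s - s'‖ ≤ 2 * ‖W s - W s'‖ := by
    intro s hs s' hs'
    have h1 := hLlip.dist_le_mul s hs s' hs'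
    rw [dist_eq_norm, dist_eq_norm] at h1
    have h2 : s - s' = (L s - L s') - (W s - W s') := by simp only [hW]; ring
    have h3 : ‖s - s'‖ ≤ ‖L s - L s'‖ + ‖W s - W s'‖ := by
      conv_lhs => rw [h2]
      exact norm_sub_le _ _
    norm_num at h1
    linarith
  have hsurj : ∀ w ∈ ball (0 : ℂ) (ρ / 4 - 4), ∃ s ∈ ball (0 : ℂ) ρ, W s = w := by
    intro w hw
    have hap : ApproximatesLinearOn W
        ((ContinuousLinearEquiv.neg ℂ : ℂ ≃L[ℂ] ℂ) : ℂ →L[ℂ] ℂ) (ball 0 ρ) (1 / 2) := by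
      refine LipschitzOnWith.approximatesLinearOn ?_
      convert hLlip using 1
      ext s
      simp [hW]
    have hsub : closedBall (0 : ℂ) (ρ / 2) ⊆ ball 0 ρ := closedBall_subset_ball (by linarith)
    have := hap.surjOn_closedBall_of_nonlinearRightInverse
      (ContinuousLinearEquiv.neg ℂ : ℂ ≃L[ℂ] ℂ).toNonlinearRightInverse
      (b := 0) (by positivity : 0 ≤ ρ / 2) hsub
    have hW0 : W 0 = L 0 := by simp [hW]
    have hnn : ((ContinuousLinearEquiv.neg ℂ : ℂ ≃L[ℂ] ℂ).toNonlinearRightInverse.nnnorm : ℝ) ≤ 1 := by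
      change ‖((ContinuousLinearEquiv.neg ℂ : ℂ ≃L[ℂ] ℂ).symm : ℂ →L[ℂ] ℂ)‖ ≤ 1
      refine ContinuousLinearMap.opNorm_le_bound _ zero_le_one fun x => ?_
      simp
    have hnn0 : 0 < ((ContinuousLinearEquiv.neg ℂ : ℂ ≃L[ℂ] ℂ).toNonlinearRightInverse.nnnorm : ℝ) := by
      change 0 < ‖((ContinuousLinearEquiv.neg ℂ : ℂ ≃L[ℂ] ℂ).symm : ℂ →L[ℂ] ℂ)‖
      exact ContinuousLinearEquiv.norm_symm_pos _
    have hmem : w ∈ closedBall (W 0)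
        ((((ContinuousLinearEquiv.neg ℂ : ℂ ≃L[ℂ] ℂ).toNonlinearRightInverse.nnnorm : ℝ)⁻¹
          - (1 / 2 : NNReal)) * (ρ / 2)) := by
      rw [mem_closedBall, dist_eq_norm, hW0]
      have h1 : ‖w‖ < ρ / 4 - 4 := by simpa using hw
      have h2 := norm_sub_le w (L 0)
      have h3 := (one_le_inv₀ hnn0).2 hnn
      push_cast
      nlinarith
    obtain ⟨s, hs, hs'⟩ := this hmem
    exact ⟨s, hsub hs, hs'⟩
  choose! S hSmem hS using hsurj
  refine ⟨S, fun w hw => ⟨hSmem w hw, ?_, fun w' hw' h => ?_⟩⟩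
  · have hcont : ContinuousAt S w := by
      refine continuousAt_of_locally_lipschitz (r := ρ / 4 - 4 - ‖w‖)
        (by simpa using hw) 2 fun w' hw' => ?_
      have hw'' : w' ∈ ball (0 : ℂ) (ρ / 4 - 4) := by
        rw [dist_eq_norm] at hw'
        have := norm_sub_norm_le w' w
        rw [mem_ball_zero_iff]
        linarith
      have := hanti _ (hSmem w' hw'') _ (hSmem w hw)
      rwa [hS w' hw'', hS w hw, ← dist_eq_norm, ← dist_eq_norm] at this
    have hder : (-1 + (q (S w) - (k (S w))⁻¹) / q (S w)) =
        (u * exp w * exp (S w) * k (S w))⁻¹ := by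
      have hk' := hk0 _ (hSmem w hw)
      have hq' : q (S w) ≠ 0 := slitPlane_ne_zero (hqslit _ (hSmem w hw))
      have hexp : u * exp w * exp (S w) = -q (S w) := by
        have h1 : exp w = exp (-S w) * (q (S w) * -u⁻¹) := by
          conv_lhs => rw [← hS w hw]
          simp only [hW, hL]
          rw [exp_add, exp_add, exp_log hq', exp_log (neg_ne_zero.2 (inv_ne_zero hu0))]
        have h2 : exp (-S w) * exp (S w) = 1 := by rw [← exp_add]; simp
        have h3 : u * u⁻¹ = 1 := mul_inv_cancel₀ hu0
        rw [h1]
        linear_combination (-u * q (S w) * u⁻¹) * h2 - q (S w) * h3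
      rw [hexp]
      field_simp
      ring
    have hne : (u * exp w * exp (S w) * k (S w))⁻¹ ≠ 0 :=
      inv_ne_zero (mul_ne_zero (mul_ne_zero (mul_ne_zero hu0 (exp_ne_zero _)) (exp_ne_zero _))
        (hk0 _ (hSmem w hw)))
    have := HasDerivAt.of_local_left_inverse hcont (hder ▸ hWd _ (hSmem w hw)) hne
      (by filter_upwards [isOpen_ball.mem_nhds hw] with w' hw' using hS w' hw')
    simpa using this
  · rw [← hS w hw, ← hS w' hw', h]

/-- Logarithmic charts conjugating a fast growing holomorphic vector field, after rescaling time,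
to `d/dw` on large annuli with many sheets. -/
theorem exists_annular_chart {f : ℂ → ℂ} {R : ℝ} (hR : 1 ≤ R)
    (hfc : ContinuousOn f {z | R ≤ ‖z‖}) (hfd : DifferentiableOn ℂ f {z | R < ‖z‖})
    (hlarge : ∀ (D : ℝ) (m : ℕ), ∃ z, R ≤ ‖z‖ ∧ D * ‖z‖ ^ m < ‖f z‖)
    (K τ : ℝ) (hK : 0 < K) (hτ : 0 < τ) :
    ∃ (T : ℝ) (Z : ℂ → ℂ), 0 < T ∧ T < τ ∧ ∀ w ∈ ball (0 : ℂ) K, R < ‖Z w‖ ∧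
      HasDerivAt Z (exp w * (T * f (Z w))) w ∧
      ∀ w' ∈ ball (0 : ℂ) K, Z w = Z w' → w = w' := by
  set ρ := 4 * (K + 4) with hρdef
  have hρ : 0 < ρ := by positivity
  obtain ⟨ε, hε, hchart⟩ := exists_log_chart ρ hρ
  have hρK : ρ / 4 - 4 = K := by rw [hρdef]; ring
  rw [hρK] at hchart
  obtain ⟨A, hA1, hA2, hA3⟩ : ∃ A : ℕ, 0 < A ∧ 4 * ρ ≤ A ∧
      Real.exp (2 * (2 * ρ) ^ 2 / A) ≤ 1 + ε / 2 := by
    have h1 : Tendsto (fun A : ℕ => Real.exp (2 * (2 * ρ) ^ 2 / A)) atTop (𝓝 1) := by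
      have := (tendsto_const_div_atTop_nhds_zero_nat (2 * (2 * ρ) ^ 2)).rexp
      rwa [Real.exp_zero] at this
    obtain ⟨A, h⟩ := ((h1.eventually_le_const (by linarith : 1 < 1 + ε / 2)).and
      ((eventually_gt_atTop 0).and
        (tendsto_natCast_atTop_atTop.eventually_ge_atTop (4 * ρ)))).exists
    exact ⟨A, h.2.1, h.2.2, h.1⟩
  obtain ⟨n, hn⟩ := exists_nat_ge (2 * ρ)
  have hn0 : 0 < n := by
    have : (0 : ℝ) < n := by linarith
    exact_mod_cast this
  obtain ⟨z₀, N, hz₀, hB, hnN, hdom⟩ :=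
    exists_point_dominated hR hfc hlarge n A hn0 hA1 (1 / τ)
  have hz₀0 : z₀ ≠ 0 := norm_pos_iff.1 (by linarith)
  have hN1 : 1 ≤ N := le_trans (by exact_mod_cast hn0) hnN
  have hN0 : 0 < N := by linarith
  have hNc : (N : ℂ) ≠ 0 := by exact_mod_cast hN0.ne'
  set a := f z₀ / z₀ with ha
  have ha0 : 0 < ‖a‖ := lt_trans (by positivity) hB
  have ha0' : a ≠ 0 := norm_pos_iff.1 ha0
  have hdom' : ∀ s ∈ ball (0 : ℂ) (2 * ρ), R < ‖z₀ * exp (s / N)‖ ∧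
      ‖f (z₀ * exp (s / N)) / (z₀ * exp (s / N))‖ ≤
          ‖a‖ * Real.exp (s.re + 2 * ‖s‖ ^ 2 / A) := by
    intro s hs
    have hs' : ‖s‖ < 2 * ρ := by simpa using hs
    exact hdom s (by linarith) (by linarith)
  set k : ℂ → ℂ := fun s => f (z₀ * exp (s / N)) / (z₀ * exp (s / N)) / a * exp (-s) with hk
  have hkd : DifferentiableOn ℂ k (ball 0 (2 * ρ)) := by
    intro s hs
    have hopen : IsOpen {z : ℂ | R < ‖z‖} := isOpen_lt continuous_const continuous_norm
    have h1 : DifferentiableAt ℂ f (z₀ * exp (s / N)) :=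
      hfd.differentiableAt (hopen.mem_nhds (hdom' s hs).1)
    have h2 : DifferentiableAt ℂ (fun s : ℂ => z₀ * exp (s / N)) s := by fun_prop
    have h3 : DifferentiableAt ℂ (fun s : ℂ => f (z₀ * exp (s / N))) s := h1.comp s h2
    refine (((h3.div h2 ?_).div_const a).mul (by fun_prop)).differentiableWithinAt
    exact mul_ne_zero hz₀0 (exp_ne_zero _)
  have hk0 : k 0 = 1 := by simp [hk, ← ha, ha0']
  have hkle : ∀ s ∈ ball (0 : ℂ) (2 * ρ), ‖k s‖ ≤ 1 + ε / 2 := by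
    intro s hs
    have hs' : ‖s‖ < 2 * ρ := by simpa using hs
    refine le_trans ?_ hA3
    simp only [hk]
    rw [norm_mul, norm_div _ a, norm_exp, neg_re]
    calc _ ≤ (‖a‖ * Real.exp (s.re + 2 * ‖s‖ ^ 2 / A)) / ‖a‖ * Real.exp (-s.re) := by
          gcongr; exact (hdom' s hs).2
      _ = Real.exp (2 * ‖s‖ ^ 2 / A) := by
          rw [mul_div_cancel_left₀ _ ha0.ne', ← Real.exp_add]; congr 1; ring
      _ ≤ _ := by gcongr
  have hk1 := norm_sub_one_le_of_norm_le hρ (by linarith : 0 < ε / 2) hkd hk0 hkle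
  obtain ⟨S, hS⟩ := hchart k (a / ‖a‖) (by simp [ha0'])
    (hkd.mono (ball_subset_ball (by linarith))) (by simpa using fun s hs => (hk1 s hs).trans_eq (by ring))
  refine ⟨1 / (N * ‖a‖), fun w => z₀ * exp (S w / N), by positivity, ?_, fun w hw => ?_⟩
  · rw [div_lt_iff₀ (by positivity)]
    rw [div_lt_iff₀ hτ] at hB
    nlinarith
  obtain ⟨hSw, hSd, hSi⟩ := hS w hw
  have hSw' : S w ∈ ball (0 : ℂ) (2 * ρ) := ball_subset_ball (by linarith) hSw
  refine ⟨(hdom' _ hSw').1, ?_, fun w' hw' h => hSi w' hw' ?_⟩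
  · refine ((hSd.div_const (N : ℂ)).cexp.const_mul z₀).congr_deriv ?_
    have hna : (‖a‖ : ℂ) ≠ 0 := by exact_mod_cast ha0.ne'
    have he : exp (-S w) * exp (S w) = 1 := by rw [← exp_add]; simp
    have hfk : f (z₀ * exp (S w / N)) = k (S w) * exp (S w) * a * (z₀ * exp (S w / N)) := by
      simp only [hk]
      have := exp_ne_zero (S w / N)
      rw [exp_neg]
      field_simp
    rw [hfk]
    push_cast
    field_simp
  · obtain ⟨hSw1, -, -⟩ := hS w' hw'
    have h1 : exp (S w / N) = exp (S w' / N) := mul_left_cancel₀ hz₀0 h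
    have him : ∀ s ∈ ball (0 : ℂ) ρ, |(s / N).im| ≤ 1 := by
      intro s hs
      have hs' : ‖s‖ < ρ := by simpa using hs
      refine (abs_im_le_norm _).trans ?_
      rw [norm_div, norm_real, Real.norm_eq_abs, abs_of_pos hN0, div_le_one hN0]
      linarith
    have h2 := abs_le.1 (him _ hSw)
    have h3 := abs_le.1 (him _ hSw1)
    have hpi := Real.pi_gt_three
    have := exp_inj_of_neg_pi_lt_of_le_pi (by linarith) (by linarith) (by linarith)
      (by linarith) h1
    field_simp at this
    exact this

/-- `Ψ` solves `Ψ' = v ∘ Ψ` in complex time on `Ω`, with values in `U`. -/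
def IsComplexSolution (v : ℂ → ℂ) (U : Set ℂ) (Ψ : ℂ → ℂ) (Ω : Set ℂ) : Prop :=
  ∀ w ∈ Ω, Ψ w ∈ U ∧ HasDerivAt Ψ (v (Ψ w)) w

/-- `γ` solves `γ' = v ∘ γ` in real time on `I`, with values in `U`. -/
def IsRealSolution (v : ℂ → ℂ) (U : Set ℂ) (γ : ℝ → ℂ) (I : Set ℝ) : Prop :=
  ∀ t ∈ I, γ t ∈ U ∧ HasDerivAt γ (v (γ t)) t

theorem exists_lipschitzOnWith_of_differentiableOn {v : ℂ → ℂ} {U : Set ℂ} (hU : IsOpen U)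
    (hv : DifferentiableOn ℂ v U) {p : ℂ} (hp : p ∈ U) :
    ∃ K : NNReal, ∃ t ∈ 𝓝 p, LipschitzOnWith K v t := by
  have h : ContDiffAt ℂ 1 v p := (hv.analyticAt (hU.mem_nhds hp)).contDiffAt
  exact h.exists_lipschitzOnWith

theorem IsRealSolution.eqOn {v : ℂ → ℂ} {U : Set ℂ} (hU : IsOpen U)
    (hv : DifferentiableOn ℂ v U) {γ₁ γ₂ : ℝ → ℂ} {I : Set ℝ} (hI : IsOpen I)
    (hIc : IsPreconnected I) (h₁ : IsRealSolution v U γ₁ I) (h₂ : IsRealSolution v U γ₂ I)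
    {t₀ : ℝ} (ht₀ : t₀ ∈ I) (heq : γ₁ t₀ = γ₂ t₀) : EqOn γ₁ γ₂ I := by
  have hloc : ∀ t ∈ I, γ₁ t = γ₂ t → γ₁ =ᶠ[𝓝 t] γ₂ := by
    intro t ht h
    obtain ⟨K, s, hs, hK⟩ := exists_lipschitzOnWith_of_differentiableOn hU hv (h₁ t ht).1
    refine ODE_solution_unique_of_eventually (v := fun _ => v) (s := fun _ => s) (K := K)
      (Eventually.of_forall fun _ => hK) ?_ ?_ h
    · filter_upwards [hI.mem_nhds ht, (h₁ t ht).2.continuousAt.preimage_mem_nhds hs] with u hu hu'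
      exact ⟨(h₁ u hu).2, hu'⟩
    · filter_upwards [hI.mem_nhds ht,
        (h₂ t ht).2.continuousAt.preimage_mem_nhds (h ▸ hs)] with u hu hu'
      exact ⟨(h₂ u hu).2, hu'⟩
  have hsub : I ⊆ {t | γ₁ =ᶠ[𝓝 t] γ₂} := by
    refine hIc.subset_of_closure_inter_subset ?_ ⟨t₀, ht₀, hloc t₀ ht₀ heq⟩ ?_
    · exact isOpen_setOfPred_eventually_nhds
    · rintro t ⟨htc, ht⟩
      refine hloc t ht ?_
      have hfr : ∃ᶠ u in 𝓝 t, γ₁ u = γ₂ u :=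
        (mem_closure_iff_frequently.1 htc).mono fun u hu => hu.self_of_nhds
      by_contra hne
      exact hfr (((h₁ t ht).2.continuousAt.ne_iff_eventually_ne (h₂ t ht).2.continuousAt).1 hne)
  exact fun t ht => (hsub ht).self_of_nhds

theorem IsComplexSolution.mono {v : ℂ → ℂ} {U : Set ℂ} {Ψ : ℂ → ℂ} {Ω Ω' : Set ℂ}
    (h : IsComplexSolution v U Ψ Ω) (hsub : Ω' ⊆ Ω) : IsComplexSolution v U Ψ Ω' :=
  fun w hw => h w (hsub hw)

theorem IsRealSolution.mono {v : ℂ → ℂ} {U : Set ℂ} {γ : ℝ → ℂ} {I I' : Set ℝ}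
    (h : IsRealSolution v U γ I) (hsub : I' ⊆ I) : IsRealSolution v U γ I' :=
  fun w hw => h w (hsub hw)

theorem IsComplexSolution.comp_add {v : ℂ → ℂ} {U : Set ℂ} {Ψ : ℂ → ℂ} {Ω Ω' : Set ℂ}
    (h : IsComplexSolution v U Ψ Ω) (c : ℂ) (hsub : ∀ w ∈ Ω', w + c ∈ Ω) :
    IsComplexSolution v U (fun w => Ψ (w + c)) Ω' :=
  fun w hw => ⟨(h _ (hsub w hw)).1, (h _ (hsub w hw)).2.comp_add_const w c⟩

theorem IsRealSolution.comp_add {v : ℂ → ℂ} {U : Set ℂ} {γ : ℝ → ℂ} {I I' : Set ℝ}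
    (h : IsRealSolution v U γ I) (c : ℝ) (hsub : ∀ t ∈ I', t + c ∈ I) :
    IsRealSolution v U (fun t => γ (t + c)) I' :=
  fun w hw => ⟨(h _ (hsub w hw)).1, (h _ (hsub w hw)).2.comp_add_const w c⟩

theorem IsComplexSolution.isRealSolution {v : ℂ → ℂ} {U : Set ℂ} {Ψ : ℂ → ℂ} {Ω : Set ℂ}
    (h : IsComplexSolution v U Ψ Ω) (c : ℂ) {I : Set ℝ} (hsub : ∀ t ∈ I, c + (t : ℂ) ∈ Ω) :
    IsRealSolution v U (fun t => Ψ (c + t)) I := by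
  intro t ht
  refine ⟨(h _ (hsub t ht)).1, ?_⟩
  exact ((h _ (hsub t ht)).2.comp_const_add c (t : ℂ)).comp_ofReal

theorem IsComplexSolution.congr {v : ℂ → ℂ} {U : Set ℂ} {Ψ Ψ' : ℂ → ℂ} {Ω : Set ℂ}
    (h : IsComplexSolution v U Ψ Ω) (hΩ : IsOpen Ω) (heq : EqOn Ψ' Ψ Ω) :
    IsComplexSolution v U Ψ' Ω := by
  intro w hw
  rw [heq hw]
  exact ⟨(h w hw).1, (h w hw).2.congr_of_eventuallyEq (heq.eventuallyEq_of_mem (hΩ.mem_nhds hw))⟩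

theorem IsComplexSolution.eqOn {v : ℂ → ℂ} {U : Set ℂ} (hU : IsOpen U)
    (hv : DifferentiableOn ℂ v U) {Ψ₁ Ψ₂ : ℂ → ℂ} {Ω : Set ℂ} (hΩ : IsOpen Ω)
    (hΩc : Convex ℝ Ω) (h₁ : IsComplexSolution v U Ψ₁ Ω) (h₂ : IsComplexSolution v U Ψ₂ Ω)
    {c : ℂ} (hc : c ∈ Ω) (heq : Ψ₁ c = Ψ₂ c) : EqOn Ψ₁ Ψ₂ Ω := by
  have hd : ∀ Ψ, IsComplexSolution v U Ψ Ω → AnalyticOnNhd ℂ Ψ Ω := fun Ψ h =>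
    DifferentiableOn.analyticOnNhd
      (fun w hw => (h w hw).2.differentiableAt.differentiableWithinAt) hΩ
  refine (hd _ h₁).eqOn_of_preconnected_of_frequently_eq (hd _ h₂) hΩc.isPreconnected hc ?_
  obtain ⟨r, hr, hball⟩ := Metric.isOpen_iff.1 hΩ c hc
  have hsub : ∀ t ∈ Ioo (-r) r, c + (t : ℂ) ∈ Ω := by
    intro t ht
    refine hball ?_
    simp only [mem_ball, dist_self_add_left, norm_real, Real.norm_eq_abs]
    exact abs_lt.2 ht
  have hreal : EqOn (fun t : ℝ => Ψ₁ (c + t)) (fun t => Ψ₂ (c + t)) (Ioo (-r) r) :=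
    (h₁.isRealSolution c hsub).eqOn hU hv isOpen_Ioo isPreconnected_Ioo
      (h₂.isRealSolution c hsub) (t₀ := 0) (by simp [hr]) (by simpa using heq)
  have hmap : Tendsto (fun t : ℝ => c + (t : ℂ)) (𝓝[≠] 0) (𝓝[≠] c) := by
    refine tendsto_nhdsWithin_iff.2 ⟨?_, ?_⟩
    · have : Tendsto (fun t : ℝ => c + (t : ℂ)) (𝓝 0) (𝓝 (c + ((0 : ℝ) : ℂ))) :=
        Continuous.tendsto (by fun_prop) 0
      rw [ofReal_zero, add_zero] at this
      exact this.mono_left nhdsWithin_le_nhds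
    · filter_upwards [self_mem_nhdsWithin] with t ht
      simpa using ht
  refine hmap.frequently (Eventually.frequently ?_)
  exact mem_nhdsWithin_of_mem_nhds (Filter.mem_of_superset (Ioo_mem_nhds (by linarith) hr) hreal)

theorem exists_picard_sequence {v : ℂ → ℂ} {p q : ℂ} {r ε M : ℝ} {L : NNReal} (hε : 0 < ε)
    (hr : 0 < r) (hv : DifferentiableOn ℂ v (ball p (3 * ε)))
    (hL : LipschitzOnWith L v (ball p (3 * ε))) (hM : ∀ z ∈ ball p (3 * ε), ‖v z‖ ≤ M)
    (hrM : M * r ≤ ε) (hrL : L * r ≤ 1 / 2) (hq : q ∈ ball p ε) :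
    ∃ Φ : ℕ → ℂ → ℂ, (∀ n, ∀ w ∈ ball (0 : ℂ) r, ‖Φ n w - p‖ ≤ 2 * ε) ∧ (∀ n, Φ n 0 = q) ∧
      (∀ n, DifferentiableOn ℂ (Φ n) (ball (0 : ℂ) r)) ∧
      (∀ n, ∀ w ∈ ball (0 : ℂ) r, HasDerivAt (Φ (n + 1)) (v (Φ n w)) w) ∧
      ∀ n, ∀ w ∈ ball (0 : ℂ) r, ‖Φ (n + 1) w - Φ n w‖ ≤ 4 * ε * (1 / 2) ^ n := by
  rw [mem_ball, dist_eq_norm] at hq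
  have h0 : (0 : ℂ) ∈ ball (0 : ℂ) r := mem_ball_self hr
  let P : (ℂ → ℂ) → Prop := fun Φ => Φ 0 = q ∧ DifferentiableOn ℂ Φ (ball (0 : ℂ) r) ∧
    ∀ w ∈ ball (0 : ℂ) r, ‖Φ w - p‖ ≤ 2 * ε
  have hmem : ∀ z, ‖z - p‖ ≤ 2 * ε → z ∈ ball p (3 * ε) := fun z hz => by
    rw [mem_ball, dist_eq_norm]; linarith
  have step : ∀ Φ : {Φ // P Φ}, ∃ Φ' : {Φ // P Φ}, ∀ w ∈ ball (0 : ℂ) r,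
      HasDerivAt Φ'.1 (v (Φ.1 w)) w := by
    rintro ⟨Φ, hΦ0, hΦd, hΦ⟩
    have hd : DifferentiableOn ℂ (fun w => v (Φ w)) (ball (0 : ℂ) r) :=
      hv.comp hΦd fun w hw => hmem _ (hΦ w hw)
    obtain ⟨F, hF0, hF⟩ := hd.isExactOn_ball.with_val_at 0 q
    refine ⟨⟨F, hF0, fun w hw => (hF w hw).differentiableAt.differentiableWithinAt, ?_⟩, hF⟩
    intro w hw
    have h1 := (convex_ball (0 : ℂ) r).norm_image_sub_le_of_norm_hasDerivWithin_le
      (fun x hx => (hF x hx).hasDerivWithinAt) (fun x hx => hM _ (hmem _ (hΦ x hx))) h0 hw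
    have hM0 : 0 ≤ M := (norm_nonneg _).trans (hM p (mem_ball_self (by linarith)))
    have h2 : M * ‖w - 0‖ ≤ M * r := by
      gcongr
      simpa using (mem_ball_zero_iff.1 hw).le
    rw [hF0] at h1
    calc ‖F w - p‖ = ‖(F w - q) + (q - p)‖ := by ring_nf
      _ ≤ ‖F w - q‖ + ‖q - p‖ := norm_add_le _ _
      _ ≤ 2 * ε := by linarith
  choose S hS using step
  let X : ℕ → {Φ // P Φ} := fun n => Nat.rec ⟨fun _ => q, rfl, by fun_prop, fun _ _ => by
    linarith⟩ (fun _ Φ => S Φ) n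
  have hX : ∀ n, ∀ w ∈ ball (0 : ℂ) r, HasDerivAt (X (n + 1)).1 (v ((X n).1 w)) w :=
    fun n => hS (X n)
  refine ⟨fun n => (X n).1, fun n => (X n).2.2.2, fun n => (X n).2.1, fun n => (X n).2.2.1, hX, ?_⟩
  intro n
  induction n with
  | zero =>
    intro w hw
    have h1 := (X 1).2.2.2 w hw
    have h2 := (X 0).2.2.2 w hw
    calc ‖(X 1).1 w - (X 0).1 w‖ = ‖((X 1).1 w - p) - ((X 0).1 w - p)‖ := by ring_nf
      _ ≤ _ := norm_sub_le _ _
      _ ≤ 4 * ε * (1 / 2) ^ 0 := by linarith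
  | succ n ih =>
    intro w hw
    have h1 := (convex_ball (0 : ℂ) r).norm_image_sub_le_of_norm_hasDerivWithin_le
      (f := fun x => (X (n + 2)).1 x - (X (n + 1)).1 x) (C := L * (4 * ε * (1 / 2) ^ n))
      (fun x hx => ((hX (n + 1) x hx).sub (hX n x hx)).hasDerivWithinAt) (fun x hx => by
        refine (hL.norm_sub_le (hmem _ ((X (n + 1)).2.2.2 x hx)) (hmem _ ((X n).2.2.2 x hx))).trans ?_
        gcongr
        exact ih x hx) h0 hw
    simp only [(X (n + 2)).2.1, (X (n + 1)).2.1, sub_self, sub_zero] at h1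
    have hw' := (mem_ball_zero_iff.1 hw).le
    calc _ ≤ _ := h1
      _ ≤ L * (4 * ε * (1 / 2) ^ n) * r := by gcongr
      _ = (L * r) * (4 * ε * (1 / 2) ^ n) := by ring
      _ ≤ (1 / 2) * (4 * ε * (1 / 2) ^ n) := by gcongr
      _ = 4 * ε * (1 / 2) ^ (n + 1) := by ring

theorem exists_isComplexSolution {v : ℂ → ℂ} {U : Set ℂ} (hU : IsOpen U)
    (hv : DifferentiableOn ℂ v U) {p : ℂ} (hp : p ∈ U) :
    ∃ r > 0, ∃ ε > 0, ∀ q ∈ ball p ε, ∃ Ψ : ℂ → ℂ, Ψ 0 = q ∧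
      IsComplexSolution v U Ψ (ball (0 : ℂ) r) := by
  obtain ⟨L, t, ht, hL⟩ := exists_lipschitzOnWith_of_differentiableOn hU hv hp
  have hcont : ContinuousAt v p := (hv.differentiableAt (hU.mem_nhds hp)).continuousAt
  have hbd : ∀ᶠ z in 𝓝 p, ‖v z‖ < ‖v p‖ + 1 := hcont.norm.eventually_lt_const (by linarith)
  obtain ⟨δ, hδ, hball⟩ := Metric.mem_nhds_iff.1 (inter_mem (inter_mem (hU.mem_nhds hp) ht) hbd)
  set ε := δ / 3 with hεd
  have hε : 0 < ε := by positivity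
  have h3 : δ = 3 * ε := by rw [hεd]; ring
  rw [h3] at hball
  set M := ‖v p‖ + 1
  have hM0 : 0 < M := by positivity
  have hL0 : (0 : ℝ) ≤ L := L.2
  set r := min (ε / M) (1 / (2 * (L + 1)))
  have hr : 0 < r := lt_min (by positivity) (by positivity)
  have hrM : M * r ≤ ε := by
    calc M * r ≤ M * (ε / M) := by gcongr; exact min_le_left _ _
      _ = ε := by field_simp
  have hrL : L * r ≤ 1 / 2 := by
    calc (L : ℝ) * r ≤ (L + 1) * (1 / (2 * (L + 1))) := by
          gcongr
          · linarith
          · exact min_le_right _ _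
      _ = 1 / 2 := by field_simp
  refine ⟨r, hr, ε, hε, fun q hq => ?_⟩
  obtain ⟨Φ, hΦp, hΦ0, hΦd, hΦ', hΦc⟩ := exists_picard_sequence hε hr
    (hv.mono fun z hz => (hball hz).1.1) (hL.mono fun z hz => (hball hz).1.2)
    (fun z hz => (hball hz).2.le) hrM hrL hq
  have hdist : ∀ w ∈ ball (0 : ℂ) r, ∀ n, dist (Φ n w) (Φ (n + 1) w) ≤ 4 * ε * (1 / 2) ^ n :=
    fun w hw n => by rw [dist_comm, dist_eq_norm]; exact hΦc n w hw
  have hlim : ∀ w, ∃ l, w ∈ ball (0 : ℂ) r → Tendsto (fun n => Φ n w) atTop (𝓝 l) := by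
    intro w
    by_cases hw : w ∈ ball (0 : ℂ) r
    · obtain ⟨l, hl⟩ := cauchySeq_tendsto_of_complete
        (cauchySeq_of_le_geometric (1 / 2) (4 * ε) (by norm_num) (hdist w hw))
      exact ⟨l, fun _ => hl⟩
    · exact ⟨0, fun h => absurd h hw⟩
  choose Ψ hΨ using hlim
  have hgeo : Tendsto (fun n : ℕ => 4 * ε * (1 / 2 : ℝ) ^ n / (1 - 1 / 2)) atTop (𝓝 0) := by
    have := ((tendsto_pow_atTop_nhds_zero_of_lt_one (r := (1 / 2 : ℝ)) (by norm_num)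
      (by norm_num)).const_mul (4 * ε)).div_const (1 - 1 / 2)
    simpa using this
  have hunif : TendstoUniformlyOn Φ Ψ atTop (ball (0 : ℂ) r) := by
    rw [Metric.tendstoUniformlyOn_iff]
    intro η hη
    filter_upwards [hgeo.eventually_lt_const hη] with n hn w hw
    rw [dist_comm]
    exact (dist_le_of_le_geometric_of_tendsto (1 / 2) (4 * ε) (by norm_num) (hdist w hw)
      (hΨ w hw) n).trans_lt hn
  have hloc := hunif.tendstoLocallyUniformlyOn
  have hdiff := hloc.differentiableOn (Eventually.of_forall hΦd) isOpen_ball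
  have hder := hloc.deriv (Eventually.of_forall hΦd) isOpen_ball
  have hΨp : ∀ w ∈ ball (0 : ℂ) r, Ψ w ∈ ball p (3 * ε) := by
    intro w hw
    have : ‖Ψ w - p‖ ≤ 2 * ε :=
      le_of_tendsto ((hΨ w hw).sub_const p).norm (Eventually.of_forall fun n => hΦp n w hw)
    rw [mem_ball, dist_eq_norm]; linarith
  refine ⟨Ψ, ?_, fun w hw => ⟨(hball (hΨp w hw)).1.1, ?_⟩⟩
  · have h := hΨ 0 (mem_ball_self hr)
    simp only [hΦ0] at h
    exact (tendsto_nhds_unique h tendsto_const_nhds)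
  · have h1 : Tendsto (fun n => deriv (Φ (n + 1)) w) atTop (𝓝 (deriv Ψ w)) :=
      (hder.tendsto_at hw).comp (tendsto_add_atTop_nat 1)
    have h2 : Tendsto (fun n => v (Φ n w)) atTop (𝓝 (v (Ψ w))) :=
      ((hv.differentiableAt (hU.mem_nhds (hball (hΨp w hw)).1.1)).continuousAt.tendsto).comp
        (hΨ w hw)
    have h3 : (fun n => deriv (Φ (n + 1)) w) = fun n => v (Φ n w) :=
      funext fun n => (hΦ' n w hw).deriv
    rw [h3] at h1
    rw [← tendsto_nhds_unique h1 h2]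
    exact (hdiff.differentiableAt (isOpen_ball.mem_nhds hw)).hasDerivAt

/-- The solution of `Ψ' = v ∘ Ψ`, `Ψ 0 = p` exists on a complex neighbourhood of `[0, x]`. -/
def HasThinStrip (v : ℂ → ℂ) (U : Set ℂ) (p : ℂ) (x : ℝ) : Prop :=
  ∃ δ > 0, ∃ Ψ : ℂ → ℂ, Ψ 0 = p ∧
    IsComplexSolution v U Ψ (Ioo (-δ) (x + δ) ×ℂ Ioo (-δ) δ)

theorem isOpen_Ioo_reProdIm_Ioo (a b c d : ℝ) : IsOpen (Ioo a b ×ℂ Ioo c d) :=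
  isOpen_Ioo.reProdIm isOpen_Ioo

theorem convex_Ioo_reProdIm_Ioo (a b c d : ℝ) : Convex ℝ (Ioo a b ×ℂ Ioo c d) :=
  ((convex_Ioo a b).linear_preimage Complex.reLm).inter
    ((convex_Ioo c d).linear_preimage Complex.imLm)

theorem HasThinStrip.mono {v : ℂ → ℂ} {U : Set ℂ} {p : ℂ} {x y : ℝ} (h : HasThinStrip v U p y)
    (hxy : x ≤ y) : HasThinStrip v U p x := by
  obtain ⟨δ, hδ, Ψ, h0, hΨ⟩ := h
  refine ⟨δ, hδ, Ψ, h0, hΨ.mono ?_⟩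
  rintro w ⟨h1, h2⟩
  exact ⟨⟨h1.1, h1.2.trans_le (by linarith)⟩, h2⟩

theorem hasThinStrip_zero {v : ℂ → ℂ} {U : Set ℂ} (hU : IsOpen U) (hv : DifferentiableOn ℂ v U)
    {p : ℂ} (hp : p ∈ U) : HasThinStrip v U p 0 := by
  obtain ⟨r, hr, ε, hε, h⟩ := exists_isComplexSolution hU hv hp
  obtain ⟨Ψ, h0, hΨ⟩ := h p (mem_ball_self hε)
  refine ⟨r / 2, by positivity, Ψ, h0, hΨ.mono ?_⟩
  rintro w ⟨⟨h1, h2⟩, ⟨h3, h4⟩⟩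
  rw [mem_ball_zero_iff]
  have h5 : |w.re| < r / 2 := abs_lt.2 ⟨h1, by linarith⟩
  have h6 : |w.im| < r / 2 := abs_lt.2 ⟨h3, h4⟩
  linarith [norm_le_abs_re_add_abs_im w]

theorem IsComplexSolution.hasThinStrip_of_ball {v : ℂ → ℂ} {U : Set ℂ} (hU : IsOpen U)
    (hv : DifferentiableOn ℂ v U) {Ψ G : ℂ → ℂ} {t δ r : ℝ} (ht : 0 ≤ t) (hδ : 0 < δ) (hr : 0 < r)
    (hΨ : IsComplexSolution v U Ψ (Ioo (-δ) (t + δ) ×ℂ Ioo (-δ) δ))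
    (hG : IsComplexSolution v U G (ball (0 : ℂ) r)) (hG0 : G 0 = Ψ t) :
    HasThinStrip v U (Ψ 0) (t + r / 2) := by
  classical
  set A := Ioo (-δ) (t + δ) ×ℂ Ioo (-δ) δ with hA
  set B := ball (t : ℂ) r
  have hAo : IsOpen A := isOpen_Ioo_reProdIm_Ioo _ _ _ _
  have hB : IsComplexSolution v U (fun w => G (w + -t)) B :=
    hG.comp_add (-t) fun w hw => by
      rw [mem_ball_zero_iff, ← sub_eq_add_neg, ← dist_eq_norm]; exact hw
  have hEq : EqOn Ψ (fun w => G (w + -t)) (A ∩ B) := by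
    refine IsComplexSolution.eqOn hU hv (hAo.inter isOpen_ball)
      ((convex_Ioo_reProdIm_Ioo _ _ _ _).inter (convex_ball _ _))
      (hΨ.mono inter_subset_left) (hB.mono inter_subset_right) (c := t) ⟨⟨?_, ?_⟩, ?_⟩ ?_
    · simp only [mem_preimage, ofReal_re]; constructor <;> linarith
    · simp [hδ]
    · exact mem_ball_self hr
    · simp [hG0]
  set Ψ' : ℂ → ℂ := fun w => if w ∈ A then Ψ w else G (w + -t) with hΨ'
  have h1 : EqOn Ψ' Ψ A := fun w hw => if_pos hw
  have h2 : EqOn Ψ' (fun w => G (w + -t)) B := by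
    intro w hw
    by_cases hwA : w ∈ A
    · rw [h1 hwA]; exact hEq ⟨hwA, hw⟩
    · exact if_neg hwA
  have h3 := hΨ.congr hAo h1
  have h4 := hB.congr isOpen_ball h2
  refine ⟨min δ (r / 8), lt_min hδ (by positivity), Ψ', h1 ?_, ?_⟩
  · refine ⟨?_, ?_⟩
    · simp only [mem_preimage, zero_re]; constructor <;> linarith
    · simp [hδ]
  · rintro w ⟨⟨h5, h6⟩, ⟨h7, h8⟩⟩
    have hm1 := min_le_left δ (r / 8)
    have hm2 := min_le_right δ (r / 8)
    by_cases hw : w.re < t + δ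
    · exact h3 w ⟨⟨by linarith, hw⟩, ⟨by linarith, by linarith⟩⟩
    · refine h4 w ?_
      rw [mem_ball, dist_eq_norm]
      have h9 : |(w - t).re| < 5 * r / 8 := by
        rw [sub_re, ofReal_re, abs_of_nonneg (by linarith)]; linarith
      have h10 : |(w - t).im| < r / 8 := by
        rw [sub_im, ofReal_im, sub_zero]
        exact abs_lt.2 ⟨by linarith, by linarith⟩
      linarith [norm_le_abs_re_add_abs_im (w - t)]

theorem exists_crossing {g : ℝ → ℝ} {c d A B : ℝ} (hcd : c ≤ d) (hg : ContinuousOn g (Icc c d))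
    (hA : A ≤ g c) (hB : g d ≤ B) (hBA : B < A) :
    ∃ a b, c ≤ a ∧ a ≤ b ∧ b ≤ d ∧ g a = A ∧ g b = B ∧ ∀ t ∈ Icc a b, g t ∈ Icc B A := by
  obtain ⟨b, ⟨hb, hgb⟩, hbl⟩ : ∃ b, IsLeast (Icc c d ∩ g ⁻¹' Iic B) b :=
    (isCompact_Icc.of_isClosed_subset (hg.preimage_isClosed_of_isClosed isClosed_Icc isClosed_Iic)
      inter_subset_left).exists_isLeast ⟨d, ⟨hcd, le_rfl⟩, hB⟩
  have hgc : ContinuousOn g (Icc c b) := hg.mono (Icc_subset_Icc_right hb.2)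
  have hgb' : g b = B := by
    obtain ⟨b', hb', hgb'⟩ := intermediate_value_Icc' hb.1 hgc ⟨hgb, by linarith⟩
    rw [← le_antisymm hb'.2 (hbl ⟨⟨hb'.1, hb'.2.trans hb.2⟩, hgb'.le⟩), hgb']
  obtain ⟨a, ⟨ha, hga⟩, hag⟩ : ∃ a, IsGreatest (Icc c b ∩ g ⁻¹' Ici A) a :=
    (isCompact_Icc.of_isClosed_subset (hgc.preimage_isClosed_of_isClosed isClosed_Icc isClosed_Ici)
      inter_subset_left).exists_isGreatest ⟨c, ⟨le_rfl, hb.1⟩, hA⟩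
  have hga' : g a = A := by
    obtain ⟨a', ha', hga'⟩ := intermediate_value_Icc' ha.2 (hgc.mono (Icc_subset_Icc_left ha.1))
      ⟨hgb'.le.trans hBA.le, hga⟩
    rw [← le_antisymm (hag ⟨⟨ha.1.trans ha'.1, ha'.2⟩, hga'.ge⟩) ha'.1, hga']
  refine ⟨a, b, ha.1, ha.2, hb.2, hga', hgb', fun t ht => ⟨?_, ?_⟩⟩
  · by_contra! h
    have := hbl ⟨⟨ha.1.trans ht.1, ht.2.trans hb.2⟩, h.le⟩
    rw [← le_antisymm ht.2 this] at hgb'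
    linarith
  · by_contra! h
    have := hag ⟨⟨ha.1.trans ht.1, ht.2⟩, h.le⟩
    rw [← le_antisymm this ht.1] at hga'
    linarith

theorem le_norm_of_isRealSolution {v : ℂ → ℂ} {U : Set ℂ} {R₁ M ℓ : ℝ} {γ : ℝ → ℂ} {d : ℝ}
    (hM : ∀ z, R₁ ≤ ‖z‖ → ‖z‖ ≤ R₁ + 1 → ‖v z‖ ≤ M) (hM0 : 0 ≤ M) (hMℓ : M * ℓ < 1)
    (hd : 0 ≤ d) (hdℓ : d ≤ ℓ) (hγ : IsRealSolution v U γ (Icc 0 d)) (h0 : R₁ + 1 ≤ ‖γ 0‖) :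
    R₁ ≤ ‖γ d‖ := by
  by_contra! hlt
  obtain ⟨a, b, ha, hab, hb, hga, hgb, hg⟩ := exists_crossing (g := fun t => ‖γ t‖) hd
    (fun t ht => (hγ t ht).2.continuousAt.continuousWithinAt.norm) h0 hlt.le (by linarith)
  have h := norm_image_sub_le_of_norm_deriv_le_segment' (f := γ) (f' := fun t => v (γ t)) (C := M)
    (a := a) (b := b)
    (fun t ht => (hγ t ⟨ha.trans ht.1, ht.2.trans hb⟩).2.hasDerivWithinAt)
    (fun t ht => hM _ (hg t (Ico_subset_Icc_self ht)).1 (hg t (Ico_subset_Icc_self ht)).2) b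
    ⟨hab, le_rfl⟩
  have h1 : M * (b - a) ≤ M * ℓ := by gcongr; linarith
  have h2 := norm_sub_norm_le (γ a) (γ b)
  rw [norm_sub_rev] at h2
  linarith

theorem HasThinStrip.exists_realSolution {v : ℂ → ℂ} {U : Set ℂ} (hU : IsOpen U)
    (hv : DifferentiableOn ℂ v U) {p : ℂ} {β : ℝ} (hβ : 0 < β)
    (h : ∀ x, 0 ≤ x → x < β → HasThinStrip v U p x) :
    ∃ δ > 0, ∃ γ : ℝ → ℂ, γ 0 = p ∧ IsRealSolution v U γ (Ioo (-δ) β) ∧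
      ∀ x, 0 ≤ x → x < β → ∃ η > 0, ∃ Ψ : ℂ → ℂ, Ψ 0 = p ∧ Ψ x = γ x ∧
        IsComplexSolution v U Ψ (Ioo (-η) (x + η) ×ℂ Ioo (-η) η) := by
  choose! η hη Ψ hΨ0 hΨ using h
  have hreal : ∀ x, 0 ≤ x → x < β →
      IsRealSolution v U (fun t => Ψ x (t : ℂ)) (Ioo (-η x) (x + η x)) := by
    intro x hx hxβ
    have := (hΨ x hx hxβ).isRealSolution 0 (I := Ioo (-η x) (x + η x)) (fun t ht => by
      refine ⟨by simpa using ht, by simp [hη x hx hxβ]⟩)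
    simpa using this
  have hagree : ∀ x y, 0 ≤ x → x < β → 0 ≤ y → y < β →
      EqOn (fun t : ℝ => Ψ x t) (fun t => Ψ y t)
        (Ioo (-η x) (x + η x) ∩ Ioo (-η y) (y + η y)) := by
    intro x y hx hxβ hy hyβ
    have h1 := hη x hx hxβ
    have h2 := hη y hy hyβ
    refine ((hreal x hx hxβ).mono inter_subset_left).eqOn hU hv (isOpen_Ioo.inter isOpen_Ioo)
      (ordConnected_Ioo.inter ordConnected_Ioo).isPreconnected
      ((hreal y hy hyβ).mono inter_subset_right) (t₀ := 0) ?_ ?_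
    · constructor <;> constructor <;> linarith
    · simp [hΨ0 x hx hxβ, hΨ0 y hy hyβ]
  have h00 := hη 0 le_rfl hβ
  refine ⟨η 0, h00, fun t => Ψ (max t 0) t, by simpa using hΨ0 0 le_rfl hβ, ?_, ?_⟩
  · intro t ht
    obtain ⟨x, hx1, hx2⟩ := exists_between (max_lt ht.2 hβ)
    have hx0 : 0 ≤ x := (le_max_right t 0).trans hx1.le
    have hηx := hη x hx0 hx2
    rcases lt_or_ge t 0 with htn | htn
    · have hev : (fun s : ℝ => Ψ (max s 0) (s : ℂ)) =ᶠ[𝓝 t] fun s : ℝ => Ψ 0 s := by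
        filter_upwards [Iio_mem_nhds htn] with s hs
        rw [max_eq_right (le_of_lt hs)]
      have := hreal 0 le_rfl hβ t ⟨ht.1, by linarith⟩
      rw [hev.self_of_nhds]
      exact ⟨this.1, this.2.congr_of_eventuallyEq hev⟩
    · have hxt : t < x := (le_max_left t 0).trans_lt hx1
      have hev : (fun s : ℝ => Ψ (max s 0) (s : ℂ)) =ᶠ[𝓝 t] fun s : ℝ => Ψ x s := by
        have hm : max (-η 0) (-η x) < t := max_lt (by linarith) (by linarith)
        filter_upwards [Ioo_mem_nhds hm hxt] with s hs
        have hs1 := (le_max_left _ _).trans_lt hs.1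
        have hs2 := (le_max_right _ _).trans_lt hs.1
        refine hagree _ x (le_max_right _ _) (max_lt (hs.2.trans hx2) hβ) hx0 hx2
          ⟨?_, hs2, by linarith [hs.2]⟩
        rcases le_total s 0 with h | h
        · rw [max_eq_right h]; exact ⟨hs1, by linarith⟩
        · have := hη s h (hs.2.trans hx2)
          rw [max_eq_left h]; exact ⟨by linarith, by linarith⟩
      have := hreal x hx0 hx2 t ⟨by linarith, by linarith⟩
      rw [hev.self_of_nhds]
      exact ⟨this.1, this.2.congr_of_eventuallyEq hev⟩
  · intro x hx hxβ
    exact ⟨η x, hη x hx hxβ, Ψ x, hΨ0 x hx hxβ, by simp [max_eq_left hx], hΨ x hx hxβ⟩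

theorem exists_blowup_of_not_hasThinStrip {v : ℂ → ℂ} {R R₁ M ℓ : ℝ} {p : ℂ}
    (hv : DifferentiableOn ℂ v {z | R < ‖z‖}) (hR : R < R₁)
    (hM : ∀ z, R₁ ≤ ‖z‖ → ‖z‖ ≤ R₁ + 1 → ‖v z‖ ≤ M) (hM0 : 0 ≤ M) (hℓ : 0 < ℓ)
    (hMℓ : M * ℓ < 1) (hp : R₁ + 1 ≤ ‖p‖) (hnot : ¬ HasThinStrip v {z | R < ‖z‖} p ℓ) :
    ∃ β δ : ℝ, ∃ γ : ℝ → ℂ, 0 < β ∧ β ≤ ℓ ∧ 0 < δ ∧ γ 0 = p ∧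
      IsRealSolution v {z | R < ‖z‖} γ (Ioo (-δ) β) ∧
      Tendsto (fun t => ‖γ t‖) (𝓝[<] β) atTop := by
  have hU : IsOpen {z : ℂ | R < ‖z‖} := isOpen_lt continuous_const continuous_norm
  set U := {z : ℂ | R < ‖z‖} with hUdef
  have hUm : ∀ z, R₁ ≤ ‖z‖ → z ∈ U := fun z hz => lt_of_lt_of_le hR hz
  set S := {x | 0 ≤ x ∧ x ≤ ℓ ∧ HasThinStrip v U p x} with hS
  have hSb : BddAbove S := ⟨ℓ, fun x hx => hx.2.1⟩
  have h0S : (0 : ℝ) ∈ S := ⟨le_rfl, hℓ.le, hasThinStrip_zero hU hv (hUm p (by linarith))⟩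
  set β := sSup S
  have hβℓ : β ≤ ℓ := csSup_le ⟨0, h0S⟩ fun x hx => hx.2.1
  have hext : ∀ x, 0 ≤ x → HasThinStrip v U p x → x ≤ β := by
    intro x hx h
    have hxℓ : x ≤ ℓ := by
      by_contra! hlt
      exact hnot (h.mono hlt.le)
    exact le_csSup hSb ⟨hx, hxℓ, h⟩
  have hβ : 0 < β := by
    obtain ⟨δ, hδ, Ψ, h0, hΨ⟩ := h0S.2.2
    have : HasThinStrip v U p (δ / 2) := by
      refine ⟨δ / 2, by positivity, Ψ, h0, hΨ.mono ?_⟩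
      rintro w ⟨h1, h2⟩
      exact ⟨⟨by linarith [h1.1], by linarith [h1.2]⟩, ⟨by linarith [h2.1], by linarith [h2.2]⟩⟩
    linarith [hext _ (by positivity) this]
  have hgood : ∀ x, 0 ≤ x → x < β → HasThinStrip v U p x := by
    intro x hx hxβ
    obtain ⟨y, hy, hxy⟩ := exists_lt_of_lt_csSup ⟨0, h0S⟩ hxβ
    exact hy.2.2.mono hxy.le
  obtain ⟨δ, hδ, γ, hγ0, hγ, hstrip⟩ := HasThinStrip.exists_realSolution hU hv hβ hgood
  refine ⟨β, δ, γ, hβ, hβℓ, hδ, hγ0, hγ, ?_⟩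
  have hlow : ∀ t, 0 ≤ t → t < β → R₁ ≤ ‖γ t‖ := by
    intro t ht htβ
    exact le_norm_of_isRealSolution hM hM0 hMℓ ht (by linarith)
      (hγ.mono fun s hs => ⟨by linarith [hs.1], by linarith [hs.2]⟩) (by rw [hγ0]; exact hp)
  rw [Filter.tendsto_atTop]
  by_contra hcon
  obtain ⟨C, hC⟩ := not_forall.1 hcon
  have hCf : ∃ᶠ t in 𝓝[<] β, ‖γ t‖ < C := by
    refine (not_eventually.1 hC).mono fun t ht => not_le.1 ht
  have hpos : ∀ᶠ t in 𝓝[<] β, t ∈ Ico 0 β := by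
    filter_upwards [self_mem_nhdsWithin, mem_nhdsWithin_of_mem_nhds (Ioi_mem_nhds hβ)] with t h1 h2
    exact ⟨le_of_lt h2, h1⟩
  have hK : IsCompact (closedBall (0 : ℂ) C ∩ {z | R₁ ≤ ‖z‖}) :=
    (isCompact_closedBall _ _).inter_right (isClosed_le continuous_const continuous_norm)
  obtain ⟨p', hp', hcl⟩ := hK.exists_mapClusterPt_of_frequently (f := γ) (l := 𝓝[<] β)
    ((hCf.and_eventually hpos).mono fun t ht =>
      ⟨mem_closedBall_zero_iff.2 ht.1.le, hlow t ht.2.1 ht.2.2⟩)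
  obtain ⟨r, hr, ε, hε, hG⟩ := exists_isComplexSolution hU hv (hUm p' hp'.2)
  have hfr : ∃ᶠ t in 𝓝[<] β, γ t ∈ ball p' ε := hcl.frequently (ball_mem_nhds p' hε)
  have hnear : ∀ᶠ t in 𝓝[<] β, β - r / 4 < t :=
    mem_nhdsWithin_of_mem_nhds (Ioi_mem_nhds (by linarith))
  obtain ⟨t, ht, ht0, htn⟩ := (hfr.and_eventually (hpos.and hnear)).exists
  obtain ⟨G, hG0, hGs⟩ := hG _ ht
  obtain ⟨η, hη, Ψ, hΨ0, hΨt, hΨ⟩ := hstrip t ht0.1 ht0.2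
  have := hΨ.hasThinStrip_of_ball hU hv ht0.1 hη hr hGs (by rw [hG0, hΨt])
  rw [hΨ0] at this
  linarith [hext _ (by linarith [ht0.1]) this]

theorem IsRealSolution.le_of_tendsto_atTop {v : ℂ → ℂ} {U : Set ℂ} (hU : IsOpen U)
    (hv : DifferentiableOn ℂ v U) {γ₁ γ₂ : ℝ → ℂ} {a b a' β t : ℝ}
    (h₁ : IsRealSolution v U γ₁ (Ioo a β)) (hβ : Tendsto (fun t => ‖γ₁ t‖) (𝓝[<] β) atTop)
    (h₂ : IsRealSolution v U γ₂ (Ioo a' b)) (ht₁ : t ∈ Ioo a β) (ht₂ : t ∈ Ioo a' b)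
    (heq : γ₁ t = γ₂ t) : b ≤ β := by
  by_contra! hlt
  have hE : EqOn γ₁ γ₂ (Ioo (max a a') β) :=
    (h₁.mono (Ioo_subset_Ioo_left (le_max_left _ _))).eqOn hU hv isOpen_Ioo isPreconnected_Ioo
      (h₂.mono (Ioo_subset_Ioo (le_max_right _ _) hlt.le)) ⟨max_lt ht₁.1 ht₂.1, ht₁.2⟩ heq
  have hev : ∀ᶠ s in 𝓝[<] β, ‖γ₁ s‖ = ‖γ₂ s‖ := by
    filter_upwards [Ioo_mem_nhdsLT (max_lt (ht₁.1.trans ht₁.2) (ht₂.1.trans ht₁.2))] with s hs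
    rw [hE hs]
  have hc : Tendsto (fun s => ‖γ₂ s‖) (𝓝[<] β) (𝓝 ‖γ₂ β‖) :=
    (h₂ β ⟨ht₂.1.trans ht₁.2, hlt⟩).2.continuousAt.norm.tendsto.mono_left nhdsWithin_le_nhds
  exact not_tendsto_nhds_of_tendsto_atTop (hβ.congr' hev) _ hc

/-- The branch of the logarithm with imaginary part between `2 * j * π` and `(2 * j + 2) * π`,
cut along the positive half axis. -/
noncomputable def sheetLog (j : ℕ) (w : ℂ) : ℂ := log (-w) + (2 * j + 1) * Real.pi * I

theorem exp_sheetLog (j : ℕ) {w : ℂ} (hw : w ≠ 0) : exp (sheetLog j w) = w := by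
  have h : ((2 * j + 1) * Real.pi * I : ℂ) = Real.pi * I + j * (2 * Real.pi * I) := by ring
  rw [sheetLog, exp_add, exp_log (neg_ne_zero.2 hw), h, exp_periodic.nat_mul j, exp_pi_mul_I]
  ring

theorem hasDerivAt_sheetLog (j : ℕ) {w : ℂ} (hw : -w ∈ slitPlane) :
    HasDerivAt (sheetLog j) w⁻¹ w := by
  have h := ((hasDerivAt_id w).neg.clog hw).add_const ((2 * j + 1) * Real.pi * I : ℂ)
  exact h.congr_deriv (by rw [Pi.neg_apply, id, neg_div_neg_eq, one_div])

theorem norm_sheetLog_lt (j : ℕ) {w : ℂ} (h₁ : 1 / 2 < ‖w‖) (h₂ : ‖w‖ < 8) :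
    ‖sheetLog j w‖ < 3 + (2 * j + 2) * Real.pi := by
  have hlog : |Real.log ‖w‖| < 3 := by
    have hw : 0 < ‖w‖ := by linarith
    have h8 : (8 : ℝ) < Real.exp 3 := by
      have := Real.exp_one_gt_d9
      have h3 : Real.exp 3 = Real.exp 1 ^ 3 := by rw [← Real.exp_nat_mul]; norm_num
      rw [h3]
      calc (8 : ℝ) < 2.7 ^ 3 := by norm_num
        _ ≤ _ := by gcongr; linarith
    rw [abs_lt, Real.lt_log_iff_exp_lt hw, Real.log_lt_iff_lt_exp hw, Real.exp_neg]
    refine ⟨?_, h₂.trans h8⟩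
    have : (Real.exp 3)⁻¹ < 8⁻¹ := inv_strictAnti₀ (by norm_num) h8
    linarith
  have h := norm_le_abs_re_add_abs_im (sheetLog j w)
  have hre : (sheetLog j w).re = Real.log ‖w‖ := by
    simp [sheetLog, log_re]
  have him : (sheetLog j w).im = arg (-w) + (2 * j + 1) * Real.pi := by
    simp [sheetLog, log_im]
  have h3 : |(sheetLog j w).im| ≤ Real.pi + (2 * j + 1) * Real.pi := by
    rw [him]
    refine (abs_add_le _ _).trans (add_le_add (abs_arg_le_pi _) ?_)
    rw [abs_of_nonneg (by positivity)]
  rw [hre] at h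
  linarith

theorem sheetLog_im_mem (j : ℕ) {w : ℂ} (hw : w.re < 0) :
    2 * j * Real.pi < (sheetLog j w).im ∧ (sheetLog j w).im < 2 * (j + 1) * Real.pi := by
  have him : (sheetLog j w).im = arg (-w) + (2 * j + 1) * Real.pi := by
    simp [sheetLog, log_im]
  have h : |arg (-w)| < Real.pi / 2 := abs_arg_lt_pi_div_two_iff.2 (Or.inl (by simpa using hw))
  have := abs_lt.1 h
  have := Real.pi_pos
  rw [him]
  constructor <;> linarith

theorem isComplexSolution_sheet {v Z : ℂ → ℂ} {U : Set ℂ} {K : ℝ}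
    (hZU : ∀ w ∈ ball (0 : ℂ) K, Z w ∈ U)
    (hZ : ∀ w ∈ ball (0 : ℂ) K, HasDerivAt Z (exp w * v (Z w)) w) {j : ℕ}
    (hj : 3 + (2 * j + 2) * Real.pi ≤ K) :
    IsComplexSolution v U (fun w => Z (sheetLog j w))
      {w | -w ∈ slitPlane ∧ 1 / 2 < ‖w‖ ∧ ‖w‖ < 8} := by
  rintro w ⟨h1, h2, h3⟩
  have hm : sheetLog j w ∈ ball (0 : ℂ) K :=
    mem_ball_zero_iff.2 ((norm_sheetLog_lt j h2 h3).trans_le hj)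
  have hw : w ≠ 0 := norm_pos_iff.1 (by linarith)
  refine ⟨hZU _ hm, ?_⟩
  have := (hZ _ hm).comp w (hasDerivAt_sheetLog j h1)
  rw [exp_sheetLog j hw] at this
  rwa [mul_right_comm, mul_inv_cancel₀ hw, one_mul] at this

/-- The solutions through a vertical segment combine to a solution on a rectangle. -/
theorem exists_isComplexSolution_rectangle {v Φ : ℂ → ℂ} {U : Set ℂ} (hU : IsOpen U)
    (hv : DifferentiableOn ℂ v U)
    (hΦ : IsComplexSolution v U Φ (Ioo (-7) (-1 / 2) ×ℂ Ioo (-1) 1))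
    (hgood : ∀ y ∈ Ioo (-1 : ℝ) 1, HasThinStrip v U (Φ (-6 + y * I)) 8) :
    ∃ Ψ, IsComplexSolution v U Ψ (Ioo (-6) 2 ×ℂ Ioo (-1) 1) ∧
      EqOn Ψ Φ (Ioo (-6) (-1 / 2) ×ℂ Ioo (-1) 1) := by
  choose! δ hδ χ hχ0 hχ using hgood
  set D : ℝ → Set ℂ := fun y => Ioo (-6 - δ y) (2 + δ y) ×ℂ Ioo (y - δ y) (y + δ y) with hD
  set X : ℝ → ℂ → ℂ := fun y w => χ y (w + -(-6 + y * I)) with hX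
  have hXsol : ∀ y ∈ Ioo (-1 : ℝ) 1, IsComplexSolution v U (X y) (D y) := by
    intro y hy
    refine (hχ y hy).comp_add _ ?_
    rintro w ⟨⟨h1, h2⟩, ⟨h3, h4⟩⟩
    refine ⟨⟨?_, ?_⟩, ⟨?_, ?_⟩⟩ <;> simp <;> linarith
  have hXc : ∀ y ∈ Ioo (-1 : ℝ) 1, X y (-6 + y * I) = Φ (-6 + y * I) := by
    intro y hy
    simp only [hX, add_neg_cancel]
    exact hχ0 y hy
  have hDo : ∀ y, IsOpen (D y) := fun y => isOpen_Ioo_reProdIm_Ioo _ _ _ _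
  have hDc : ∀ y, Convex ℝ (D y) := fun y => convex_Ioo_reProdIm_Ioo _ _ _ _
  have hcm : ∀ y ∈ Ioo (-1 : ℝ) 1, ((-6 + y * I : ℂ)) ∈ D y := by
    intro y hy
    have := hδ y hy
    refine ⟨⟨?_, ?_⟩, ⟨?_, ?_⟩⟩ <;> simp <;> linarith
  have hcL : ∀ y ∈ Ioo (-1 : ℝ) 1,
      ((-6 + y * I : ℂ)) ∈ (Ioo (-7) (-1 / 2) ×ℂ Ioo (-1) 1 : Set ℂ) := by
    intro y hy
    refine ⟨⟨?_, ?_⟩, ⟨?_, ?_⟩⟩ <;> simp <;> linarith [hy.1, hy.2]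
  have hXΦ : ∀ y ∈ Ioo (-1 : ℝ) 1, EqOn (X y) Φ (D y ∩ (Ioo (-7) (-1 / 2) ×ℂ Ioo (-1) 1)) := by
    intro y hy
    exact ((hXsol y hy).mono inter_subset_left).eqOn hU hv
      ((hDo y).inter (isOpen_Ioo_reProdIm_Ioo _ _ _ _))
      ((hDc y).inter (convex_Ioo_reProdIm_Ioo _ _ _ _)) (hΦ.mono inter_subset_right)
      ⟨hcm y hy, hcL y hy⟩ (hXc y hy)
  have hmem : ∀ w : ℂ, w ∈ (Ioo (-6) 2 ×ℂ Ioo (-1) 1 : Set ℂ) → w ∈ D w.im := by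
    rintro w ⟨h1, h2⟩
    have := hδ w.im h2
    exact ⟨⟨by linarith [h1.1], by linarith [h1.2]⟩, ⟨by linarith, by linarith⟩⟩
  have hXX : ∀ y ∈ Ioo (-1 : ℝ) 1, ∀ w ∈ D y ∩ (Ioo (-6) 2 ×ℂ Ioo (-1) 1), X w.im w = X y w := by
    rintro y hy w ⟨hwD, hw⟩
    have hwim := hw.2
    have hc : (-6 + w.im * I : ℂ) ∈ D y := by
      have := hδ y hy
      refine ⟨⟨?_, ?_⟩, ⟨?_, ?_⟩⟩ <;> simp <;> linarith [hwD.2.1, hwD.2.2]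
    refine ((hXsol _ hwim).mono inter_subset_left).eqOn hU hv ((hDo w.im).inter (hDo y))
      ((hDc w.im).inter (hDc y)) ((hXsol y hy).mono inter_subset_right)
      ⟨hcm _ hwim, hc⟩ ?_ ⟨hmem w hw, hwD⟩
    rw [hXc _ hwim, hXΦ y hy ⟨hc, hcL _ hwim⟩]
  refine ⟨fun w => X w.im w, ?_, ?_⟩
  · intro w hw
    have hev : (fun w => X w.im w) =ᶠ[𝓝 w] X w.im := by
      filter_upwards [((hDo w.im).inter (isOpen_Ioo_reProdIm_Ioo _ _ _ _)).mem_nhds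
        ⟨hmem w hw, hw⟩] with w' hw'
      exact hXX _ hw.2 w' hw'
    have := hXsol _ hw.2 w (hmem w hw)
    exact ⟨this.1, this.2.congr_of_eventuallyEq hev⟩
  · rintro w ⟨h1, h2⟩
    exact hXΦ w.im h2 ⟨hmem w ⟨⟨h1.1, by linarith [h1.2]⟩, h2⟩, ⟨⟨by linarith [h1.1], h1.2⟩, h2⟩⟩

theorem exists_not_hasThinStrip {v Z : ℂ → ℂ} {U : Set ℂ} {K : ℝ} (hU : IsOpen U)
    (hv : DifferentiableOn ℂ v U) (hZU : ∀ w ∈ ball (0 : ℂ) K, Z w ∈ U)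
    (hZ : ∀ w ∈ ball (0 : ℂ) K, HasDerivAt Z (exp w * v (Z w)) w)
    (hinj : InjOn Z (ball (0 : ℂ) K)) {j : ℕ} (hj : 3 + (2 * j + 2) * Real.pi ≤ K) :
    ∃ y ∈ Ioo (-1 : ℝ) 1, ¬ HasThinStrip v U (Z (sheetLog j (-6 + y * I))) 8 := by
  by_contra! hcon
  have hsheet := isComplexSolution_sheet hZU hZ hj
  set Φ : ℂ → ℂ := fun w => Z (sheetLog j w) with hΦ
  have hbox : ∀ a b c d : ℝ, -7 ≤ a → b ≤ 7 → -1 ≤ c → d ≤ 1 →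
      (∀ w ∈ (Ioo a b ×ℂ Ioo c d : Set ℂ), -w ∈ slitPlane ∧ 1 / 2 < ‖w‖) →
      IsComplexSolution v U Φ (Ioo a b ×ℂ Ioo c d) := by
    intro a b c d ha hb hc hd h
    refine hsheet.mono fun w hw => ⟨(h w hw).1, (h w hw).2, ?_⟩
    obtain ⟨⟨h1, h2⟩, ⟨h3, h4⟩⟩ := hw
    have h5 : |w.re| < 7 := abs_lt.2 ⟨by linarith, by linarith⟩
    have h6 : |w.im| < 1 := abs_lt.2 ⟨by linarith, by linarith⟩
    linarith [norm_le_abs_re_add_abs_im w]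
  obtain ⟨Ψ, hΨ, hΨΦ⟩ := exists_isComplexSolution_rectangle hU hv
    (hbox _ _ _ _ le_rfl (by norm_num) le_rfl le_rfl (by
      rintro w ⟨⟨_, h2⟩, _⟩
      refine ⟨Or.inl (by rw [neg_re]; linarith), lt_of_lt_of_le ?_ (abs_re_le_norm w)⟩
      rw [abs_of_neg (by linarith)]; linarith)) hcon
  have key : ∀ a b c d y : ℝ, y ∈ Ioo a b → y ∈ Ioo c d → -1 ≤ a → b ≤ 1 → -1 ≤ c → d ≤ 1 →
      (∀ t ∈ Ioo a b, 1 / 2 < |t|) → (∀ t ∈ Ioo c d, t ≠ 0) →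
      EqOn Ψ Φ (Ioo (1 / 2) 2 ×ℂ Ioo c d) := by
    intro a b c d y hy hy' ha hb hc hd h1 h2
    have hs1 : EqOn Ψ Φ (Ioo (-6) 2 ×ℂ Ioo a b) := by
      refine (hΨ.mono ?_).eqOn hU hv (isOpen_Ioo_reProdIm_Ioo _ _ _ _)
        (convex_Ioo_reProdIm_Ioo _ _ _ _)
        (hbox _ _ _ _ (by norm_num) (by norm_num) ha hb ?_) (c := -5 + y * I) ?_ (hΨΦ ?_)
      · rintro w ⟨h3, h4⟩
        exact ⟨h3, ⟨by linarith [h4.1], by linarith [h4.2]⟩⟩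
      · rintro w ⟨_, h4⟩
        have h5 := h1 _ h4
        refine ⟨Or.inr ?_, h5.trans_le (abs_im_le_norm w)⟩
        rw [neg_im]
        exact neg_ne_zero.2 (abs_pos.1 (by linarith))
      · refine ⟨⟨?_, ?_⟩, ⟨?_, ?_⟩⟩ <;> simp <;> linarith [hy.1, hy.2]
      · refine ⟨⟨?_, ?_⟩, ⟨?_, ?_⟩⟩ <;> simp <;> linarith [hy.1, hy.2]
    refine (hΨ.mono ?_).eqOn hU hv (isOpen_Ioo_reProdIm_Ioo _ _ _ _)
      (convex_Ioo_reProdIm_Ioo _ _ _ _)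
      (hbox _ _ _ _ (by norm_num) (by norm_num) hc hd ?_) (c := 1 + y * I) ?_ (hs1 ?_)
    · rintro w ⟨h3, h4⟩
      exact ⟨⟨by linarith [h3.1], h3.2⟩, ⟨by linarith [h4.1], by linarith [h4.2]⟩⟩
    · rintro w ⟨h3, h4⟩
      refine ⟨Or.inr ?_, h3.1.trans_le ((le_abs_self _).trans (abs_re_le_norm w))⟩
      rw [neg_im]
      exact neg_ne_zero.2 (h2 _ h4)
    · refine ⟨⟨?_, ?_⟩, ⟨?_, ?_⟩⟩ <;> simp <;> linarith [hy'.1, hy'.2]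
    · refine ⟨⟨?_, ?_⟩, ⟨?_, ?_⟩⟩ <;> simp <;> linarith [hy.1, hy.2]
  have hpath : Tendsto (fun t : ℝ => 1 + (t : ℂ) * I) (𝓝 0) (𝓝 1) := by
    have : Tendsto (fun t : ℝ => 1 + (t : ℂ) * I) (𝓝 0) (𝓝 (1 + ((0 : ℝ) : ℂ) * I)) :=
      Continuous.tendsto (by fun_prop) 0
    simpa using this
  have hneg : Tendsto (fun t : ℝ => -(1 + (t : ℂ) * I)) (𝓝 0) (𝓝 (-1)) := hpath.neg
  have hΨ1 : ContinuousAt Ψ 1 := by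
    refine (hΨ 1 ?_).2.continuousAt
    refine ⟨⟨?_, ?_⟩, ⟨?_, ?_⟩⟩ <;> norm_num
  have hpi := Real.pi_pos
  have hend : ∀ (l : Filter ℝ) [l.NeBot] (k : ℕ), l ≤ 𝓝 0 → (k : ℝ) ≤ j + 1 →
      (∀ᶠ t : ℝ in l, Ψ (1 + t * I) = Φ (1 + t * I)) →
      Tendsto (fun t : ℝ => sheetLog j (1 + t * I)) l (𝓝 (2 * k * Real.pi * I)) →
      (2 * k * Real.pi * I : ℂ) ∈ ball (0 : ℂ) K ∧ Ψ 1 = Z (2 * k * Real.pi * I) := by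
    intro l _ k hl hk hev hlog
    have hmem : (2 * k * Real.pi * I : ℂ) ∈ ball (0 : ℂ) K := by
      rw [mem_ball_zero_iff]
      have : ‖(2 * k * Real.pi * I : ℂ)‖ = 2 * k * Real.pi := by
        simp [abs_of_pos hpi]
      rw [this]
      nlinarith
    refine ⟨hmem, ?_⟩
    have h1 : Tendsto (fun t : ℝ => Ψ (1 + t * I)) l (𝓝 (Ψ 1)) :=
      hΨ1.tendsto.comp (hpath.mono_left hl)
    have h2 : Tendsto (fun t : ℝ => Φ (1 + t * I)) l (𝓝 (Z (2 * k * Real.pi * I))) :=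
      (hZ _ hmem).continuousAt.tendsto.comp hlog
    exact tendsto_nhds_unique_of_eventuallyEq h1 h2 hev
  obtain ⟨hm₁, he₁⟩ := hend (𝓝[>] 0) j nhdsWithin_le_nhds (by linarith) (by
      filter_upwards [Ioo_mem_nhdsGT (zero_lt_one' ℝ)] with t ht
      refine key (1 / 2) 1 0 1 (3 / 4) (by norm_num) (by norm_num) (by norm_num) (by norm_num)
        (by norm_num) (by norm_num) (fun t ht => ht.1.trans_le (le_abs_self t))
        (fun t ht => ht.1.ne') ?_
      refine ⟨⟨?_, ?_⟩, ⟨?_, ?_⟩⟩ <;> simp <;> linarith [ht.1, ht.2]) (by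
    have h := (tendsto_log_nhdsWithin_im_neg_of_re_neg_of_im_zero (z := -1) (by simp)
      (by simp)).comp (tendsto_nhdsWithin_iff.2 ⟨hneg.mono_left nhdsWithin_le_nhds, by
        filter_upwards [self_mem_nhdsWithin] with t (ht : 0 < t)
        simpa using ht⟩ : Tendsto (fun t : ℝ => -(1 + (t : ℂ) * I)) (𝓝[>] 0) _)
    have h' := h.add_const ((2 * j + 1) * Real.pi * I : ℂ)
    rwa [show (Real.log ‖(-1 : ℂ)‖ : ℂ) - Real.pi * I + (2 * j + 1) * Real.pi * I =
      2 * j * Real.pi * I by simp; ring] at h')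
  obtain ⟨hm₂, he₂⟩ := hend (𝓝[<] 0) (j + 1) nhdsWithin_le_nhds (by push_cast; linarith) (by
      filter_upwards [Ioo_mem_nhdsLT (neg_one_lt_zero (R := ℝ))] with t ht
      refine key (-1) (-1 / 2) (-1) 0 (-3 / 4) (by norm_num) (by norm_num) (by norm_num)
        (by norm_num) (by norm_num) (by norm_num)
        (fun t ht => lt_of_lt_of_le (by linarith [ht.2]) (neg_le_abs t))
        (fun t ht => ht.2.ne) ?_
      refine ⟨⟨?_, ?_⟩, ⟨?_, ?_⟩⟩ <;> simp <;> linarith [ht.1, ht.2]) (by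
    have h := (tendsto_log_nhdsWithin_im_nonneg_of_re_neg_of_im_zero (z := -1) (by simp)
      (by simp)).comp (tendsto_nhdsWithin_iff.2 ⟨hneg.mono_left nhdsWithin_le_nhds, by
        filter_upwards [self_mem_nhdsWithin] with t (ht : t < 0)
        simpa using ht.le⟩ : Tendsto (fun t : ℝ => -(1 + (t : ℂ) * I)) (𝓝[<] 0) _)
    have h' := h.add_const ((2 * j + 1) * Real.pi * I : ℂ)
    rwa [show (Real.log ‖(-1 : ℂ)‖ : ℂ) + Real.pi * I + (2 * j + 1) * Real.pi * I =
      2 * (j + 1 : ℕ) * Real.pi * I by simp; ring] at h')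
  have h := congrArg Complex.im (hinj hm₁ hm₂ (he₁.symm.trans he₂))
  simp [hpi.ne'] at h

theorem exists_blowup_sheet {v Z : ℂ → ℂ} {R R₁ M K : ℝ}
    (hv : DifferentiableOn ℂ v {z | R < ‖z‖}) (hR : R < R₁)
    (hM : ∀ z, R₁ ≤ ‖z‖ → ‖z‖ ≤ R₁ + 1 → ‖v z‖ ≤ M) (hM0 : 0 ≤ M) (hM8 : M * 8 < 1)
    (hZR : ∀ w ∈ ball (0 : ℂ) K, R₁ + 1 ≤ ‖Z w‖)
    (hZ : ∀ w ∈ ball (0 : ℂ) K, HasDerivAt Z (exp w * v (Z w)) w)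
    (hinj : InjOn Z (ball (0 : ℂ) K)) {j : ℕ} (hj : 3 + (2 * j + 2) * Real.pi ≤ K) :
    ∃ (γ : ℝ → ℂ) (μ : ℂ), IsRealSolution v {z | R < ‖z‖} γ (Ioo (-5) 0) ∧
      Tendsto (fun t => ‖γ t‖) (𝓝[<] 0) atTop ∧ γ (-4) = Z μ ∧ μ ∈ ball (0 : ℂ) K ∧
      2 * j * Real.pi < μ.im ∧ μ.im < 2 * (j + 1) * Real.pi := by
  have hU : IsOpen {z : ℂ | R < ‖z‖} := isOpen_lt continuous_const continuous_norm
  have hZU : ∀ w ∈ ball (0 : ℂ) K, Z w ∈ {z : ℂ | R < ‖z‖} := fun w hw =>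
    show R < ‖Z w‖ by linarith [hZR w hw]
  have hbase : ∀ w ∈ (Ioo (-7) (-1 / 2) ×ℂ Ioo (-1) 1 : Set ℂ),
      -w ∈ slitPlane ∧ 1 / 2 < ‖w‖ ∧ ‖w‖ < 8 := by
    rintro w ⟨⟨h1, h2⟩, ⟨h3, h4⟩⟩
    have h5 : |w.re| < 7 := abs_lt.2 ⟨by linarith, by linarith⟩
    have h6 : |w.im| < 1 := abs_lt.2 ⟨by linarith, by linarith⟩
    refine ⟨Or.inl (by rw [neg_re]; linarith), lt_of_lt_of_le ?_ (abs_re_le_norm w),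
      by linarith [norm_le_abs_re_add_abs_im w]⟩
    rw [abs_of_neg (by linarith)]; linarith
  obtain ⟨y, hy, hnot⟩ := exists_not_hasThinStrip hU hv hZU hZ hinj hj
  set c : ℂ := -6 + y * I with hc
  have hmem : ∀ t ∈ Ioo (-1 : ℝ) (11 / 2),
      c + t ∈ (Ioo (-7) (-1 / 2) ×ℂ Ioo (-1) 1 : Set ℂ) := by
    intro t ht
    refine ⟨⟨?_, ?_⟩, ⟨?_, ?_⟩⟩ <;> simp [hc] <;> linarith [ht.1, ht.2, hy.1, hy.2]
  have hball : ∀ t ∈ Ioo (-1 : ℝ) (11 / 2), sheetLog j (c + t) ∈ ball (0 : ℂ) K := by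
    intro t ht
    obtain ⟨-, h2, h3⟩ := hbase _ (hmem t ht)
    exact mem_ball_zero_iff.2 ((norm_sheetLog_lt j h2 h3).trans_le hj)
  have hsheet : IsRealSolution v {z | R < ‖z‖} (fun t => Z (sheetLog j (c + t)))
      (Ioo (-1) (11 / 2)) :=
    (isComplexSolution_sheet hZU hZ hj).isRealSolution c fun t ht => hbase _ (hmem t ht)
  have hc0 : sheetLog j c ∈ ball (0 : ℂ) K := by
    simpa using hball 0 (by norm_num)
  obtain ⟨β, δ, γ, hβ, hβ8, hδ, hγ0, hγ, hlim⟩ := exists_blowup_of_not_hasThinStrip hv hR hM hM0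
    (by norm_num) hM8 (hZR _ hc0) hnot
  have h0 : γ 0 = Z (sheetLog j (c + (0 : ℝ))) := by rw [hγ0]; simp
  have h0γ : (0 : ℝ) ∈ Ioo (-δ) β := ⟨by linarith, hβ⟩
  have hβ5 : 11 / 2 ≤ β := hγ.le_of_tendsto_atTop hU hv hlim hsheet h0γ (by norm_num) h0
  have hE : EqOn γ (fun t => Z (sheetLog j (c + t))) (Ioo (max (-δ) (-1)) (11 / 2)) :=
    (hγ.mono (Ioo_subset_Ioo (le_max_left _ _) hβ5)).eqOn hU hv isOpen_Ioo isPreconnected_Ioo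
      (hsheet.mono (Ioo_subset_Ioo_left (le_max_right _ _))) (t₀ := 0)
      ⟨max_lt (by linarith) (by norm_num), by norm_num⟩ h0
  have h4 : β - 4 ∈ Ioo (-1 : ℝ) (11 / 2) := ⟨by linarith, by linarith⟩
  have hre : (c + (β - 4 : ℝ)).re < 0 := by linarith [(hmem _ h4).1.2]
  refine ⟨fun t => γ (t + β), sheetLog j (c + (β - 4 : ℝ)), ?_, ?_, ?_, hball _ h4,
    (sheetLog_im_mem j hre).1, (sheetLog_im_mem j hre).2⟩
  · exact hγ.comp_add β fun t ht => ⟨by linarith [ht.1], by linarith [ht.2]⟩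
  · refine hlim.comp (tendsto_nhdsWithin_iff.2 ⟨?_, ?_⟩)
    · have : Tendsto (fun t : ℝ => t + β) (𝓝 0) (𝓝 (0 + β)) := Continuous.tendsto (by fun_prop) 0
      rw [zero_add] at this
      exact this.mono_left nhdsWithin_le_nhds
    · filter_upwards [self_mem_nhdsWithin] with t (ht : t < 0)
      exact show t + β < β by linarith
  · change γ (-4 + β) = _
    rw [neg_add_eq_sub]
    exact hE ⟨max_lt (by linarith) (by linarith), h4.2⟩

theorem exists_blowup_family {f : ℂ → ℂ} {R : ℝ} (hR : 1 ≤ R)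
    (hfd : DifferentiableOn ℂ f {z | R < ‖z‖})
    (hlarge : ∀ (D : ℝ) (m : ℕ), ∃ z, R + 2 ≤ ‖z‖ ∧ D * ‖z‖ ^ m < ‖f z‖) (m : ℕ) :
    ∃ γ : Fin m → ℝ → ℂ, (∀ i, ∃ a > 0, IsRealSolution f {z | R < ‖z‖} (γ i) (Ioo (-a) 0)) ∧
      (∀ i, Tendsto (fun t => ‖γ i t‖) (𝓝[<] 0) atTop) ∧
      ∀ i j, γ i =ᶠ[𝓝[<] 0] γ j → i = j := by
  have hU : IsOpen {z : ℂ | R < ‖z‖} := isOpen_lt continuous_const continuous_norm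
  have hK : IsCompact (closedBall (0 : ℂ) (R + 2) ∩ {z | R + 1 ≤ ‖z‖}) :=
    (isCompact_closedBall _ _).inter_right (isClosed_le continuous_const continuous_norm)
  obtain ⟨M, hM⟩ := hK.exists_bound_of_continuousOn (f := f)
    (hfd.continuousOn.mono fun z hz => show R < ‖z‖ by linarith [show R + 1 ≤ ‖z‖ from hz.2])
  have hMbd : ∀ z : ℂ, R + 1 ≤ ‖z‖ → ‖z‖ ≤ R + 1 + 1 → ‖f z‖ ≤ max M 0 := fun z h1 h2 =>
    (hM z ⟨mem_closedBall_zero_iff.2 (by linarith), h1⟩).trans (le_max_left _ _)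
  set M' := max M 0
  have hM0 : 0 ≤ M' := le_max_right _ _
  set K := 3 + (2 * m + 2) * Real.pi with hKdef
  have hsub : ∀ z : ℂ, R + 2 ≤ ‖z‖ → z ∈ {z : ℂ | R < ‖z‖} := fun z hz =>
    show R < ‖z‖ by linarith
  obtain ⟨T, Z, hT, hTτ, hZ⟩ := exists_annular_chart (R := R + 2) (by linarith)
    (hfd.continuousOn.mono fun z hz => hsub z hz)
    (hfd.mono fun z hz => hsub z (le_of_lt hz)) hlarge K (1 / (8 * (M' + 1))) (by positivity)
    (by positivity)
  have hTM : T * M' * 8 < 1 := by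
    rw [lt_div_iff₀ (by positivity)] at hTτ
    linarith
  have hsheet : ∀ i : Fin m, ∃ (γ : ℝ → ℂ) (μ : ℂ),
      IsRealSolution (fun z => T * f z) {z | R < ‖z‖} γ (Ioo (-5) 0) ∧
      Tendsto (fun t => ‖γ t‖) (𝓝[<] 0) atTop ∧ γ (-4) = Z μ ∧ μ ∈ ball (0 : ℂ) K ∧
      2 * (i : ℕ) * Real.pi < μ.im ∧ μ.im < 2 * ((i : ℕ) + 1) * Real.pi := by
    intro i
    refine exists_blowup_sheet (R₁ := R + 1) (M := T * M') (hfd.const_mul _) (by linarith) ?_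
      (by positivity) hTM (fun w hw => by linarith [(hZ w hw).1]) (fun w hw => (hZ w hw).2.1)
      (fun w hw w' hw' h => (hZ w hw).2.2 w' hw' h) ?_
    · intro z h1 h2
      rw [norm_mul, norm_real, Real.norm_of_nonneg hT.le]
      gcongr
      exact hMbd z h1 h2
    · have : (i : ℝ) ≤ m := by exact_mod_cast i.2.le
      rw [hKdef]
      gcongr
  choose γ μ hγ hlim hγ4 hμ hμ1 hμ2 using hsheet
  have hdiv : Tendsto (fun t : ℝ => t / T) (𝓝[<] 0) (𝓝[<] 0) := by
    refine tendsto_nhdsWithin_iff.2 ⟨?_, ?_⟩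
    · have : Tendsto (fun t : ℝ => t / T) (𝓝 0) (𝓝 (0 / T)) := Continuous.tendsto (by fun_prop) 0
      rw [zero_div] at this
      exact this.mono_left nhdsWithin_le_nhds
    · filter_upwards [self_mem_nhdsWithin] with t ht
      exact div_neg_of_neg_of_pos ht hT
  have hmul : Tendsto (fun t : ℝ => t * T) (𝓝[<] 0) (𝓝[<] 0) := by
    refine tendsto_nhdsWithin_iff.2 ⟨?_, ?_⟩
    · have : Tendsto (fun t : ℝ => t * T) (𝓝 0) (𝓝 (0 * T)) := Continuous.tendsto (by fun_prop) 0
      rw [zero_mul] at this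
      exact this.mono_left nhdsWithin_le_nhds
    · filter_upwards [self_mem_nhdsWithin] with t ht
      exact mul_neg_of_neg_of_pos ht hT
  refine ⟨fun i t => γ i (t / T), fun i => ⟨5 * T, by positivity, fun t ht => ?_⟩,
    fun i => (hlim i).comp hdiv, fun i j hij => ?_⟩
  · have h := hγ i (t / T) ⟨by rw [lt_div_iff₀ hT]; linarith [ht.1],
      div_neg_of_neg_of_pos ht.2 hT⟩
    refine ⟨h.1, ?_⟩
    have h2 := h.2.scomp t ((hasDerivAt_id t).div_const T)
    refine h2.congr_deriv ?_
    have : (T : ℂ) ≠ 0 := ofReal_ne_zero.2 hT.ne'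
    simp only [real_smul, one_div, ofReal_inv]
    field_simp
  · have hev : γ i =ᶠ[𝓝[<] 0] γ j := by
      filter_upwards [hmul.eventually hij] with t ht
      simpa [hT.ne'] using ht
    obtain ⟨t, ht, htI⟩ :=
      (hev.and (Ioo_mem_nhdsLT (show (-5 : ℝ) < 0 by norm_num))).exists
    have hE := (hγ i).eqOn hU (hfd.const_mul _) isOpen_Ioo isPreconnected_Ioo (hγ j) htI ht
      (show (-4 : ℝ) ∈ Ioo (-5 : ℝ) 0 by norm_num)
    rw [hγ4, hγ4] at hE
    have hμe := (hZ _ (hμ i)).2.2 _ (hμ j) hE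
    have h1 := hμ1 i
    have h2 := hμ2 i
    rw [hμe] at h1 h2
    have hpi : 0 < 2 * Real.pi := by positivity
    have h3 : ((i : ℕ) : ℝ) < (j : ℕ) + 1 := by
      nlinarith [hμ2 j]
    have h4 : ((j : ℕ) : ℝ) < (i : ℕ) + 1 := by
      nlinarith [hμ1 j]
    have h5 : (i : ℕ) < j + 1 := by exact_mod_cast h3
    have h6 : (j : ℕ) < i + 1 := by exact_mod_cast h4
    exact Fin.ext (by omega)

theorem ne_of_blowup {v : ℂ → ℂ} {U : Set ℂ} (hU : IsOpen U) (hv : DifferentiableOn ℂ v U)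
    {γ₁ γ₂ : ℝ → ℂ} {a₁ a₂ : ℝ} (h₁ : IsRealSolution v U γ₁ (Ioo (-a₁) 0))
    (h₂ : IsRealSolution v U γ₂ (Ioo (-a₂) 0))
    (hlim₁ : Tendsto (fun t => ‖γ₁ t‖) (𝓝[<] 0) atTop)
    (hlim₂ : Tendsto (fun t => ‖γ₂ t‖) (𝓝[<] 0) atTop) (hne : ¬ γ₁ =ᶠ[𝓝[<] 0] γ₂)
    {s t : ℝ} (hs : s ∈ Ioo (-a₁) 0) (ht : t ∈ Ioo (-a₂) 0) : γ₁ s ≠ γ₂ t := by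
  have main : ∀ {γ₁ γ₂ : ℝ → ℂ} {a₁ a₂ s t : ℝ}, IsRealSolution v U γ₁ (Ioo (-a₁) 0) →
      IsRealSolution v U γ₂ (Ioo (-a₂) 0) → Tendsto (fun t => ‖γ₁ t‖) (𝓝[<] 0) atTop →
      s ∈ Ioo (-a₁) 0 → t ∈ Ioo (-a₂) 0 → γ₁ s = γ₂ t → s ≤ t := by
    intro γ₁ γ₂ a₁ a₂ s t h₁ h₂ hlim hs ht h
    have := h₁.le_of_tendsto_atTop hU hv hlim (γ₂ := fun u => γ₂ (u + (t - s)))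
      (a' := -a₂ - (t - s)) (b := -(t - s)) (t := s)
      (h₂.comp_add _ fun u hu => ⟨by linarith [hu.1], by linarith [hu.2]⟩) hs
      ⟨by linarith [ht.1], by linarith [ht.2]⟩ (by simpa using h)
    linarith
  intro h
  obtain rfl : s = t := le_antisymm (main h₁ h₂ hlim₁ hs ht h) (main h₂ h₁ hlim₂ ht hs h.symm)
  refine hne ?_
  have hm : max (-a₁) (-a₂) < s := max_lt hs.1 ht.1
  filter_upwards [Ioo_mem_nhdsLT (hm.trans hs.2)] with u hu
  exact (h₁.mono (Ioo_subset_Ioo_left (le_max_left _ _))).eqOn hU hv isOpen_Ioo isPreconnected_Ioo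
    (h₂.mono (Ioo_subset_Ioo_left (le_max_right _ _))) ⟨hm, hs.2⟩ h hu

theorem exists_infinite_blowup_family {f : ℂ → ℂ} {R : ℝ} (hR : 1 ≤ R)
    (hfd : DifferentiableOn ℂ f {z | R < ‖z‖})
    (hlarge : ∀ (D : ℝ) (m : ℕ), ∃ z, R + 2 ≤ ‖z‖ ∧ D * ‖z‖ ^ m < ‖f z‖) :
    ∃ γ : ℕ → ℝ → ℂ, (∀ k, ∃ a > 0, IsRealSolution f {z | R < ‖z‖} (γ k) (Ioo (-a) 0)) ∧
      (∀ k, Tendsto (fun t => ‖γ k t‖) (𝓝[<] 0) atTop) ∧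
      ∀ j k, j ≠ k → ¬ γ j =ᶠ[𝓝[<] 0] γ k := by
  let S : Set (ℝ → ℂ) := {γ | (∃ a > 0, IsRealSolution f {z | R < ‖z‖} γ (Ioo (-a) 0)) ∧
    Tendsto (fun t => ‖γ t‖) (𝓝[<] 0) atTop}
  let germ : (ℝ → ℂ) → Germ (𝓝[<] (0 : ℝ)) ℂ := fun γ => (γ : Germ (𝓝[<] (0 : ℝ)) ℂ)
  have hinf : (germ '' S).Infinite := by
    intro hfin
    obtain ⟨γ, h1, h2, h3⟩ := exists_blowup_family hR hfd hlarge (hfin.toFinset.card + 1)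
    have hle := Finset.card_le_card_of_injOn (s := Finset.univ) (t := hfin.toFinset)
      (fun i => germ (γ i)) (fun i _ => by
        simpa using ⟨γ i, ⟨h1 i, h2 i⟩, rfl⟩)
      (fun i _ j _ hij => h3 i j (Germ.coe_eq.1 hij))
    simp at hle
  have hmem := fun k => (hinf.natEmbedding _ k).2
  choose γ hγ hγg using hmem
  refine ⟨γ, fun k => (hγ k).1, fun k => (hγ k).2, fun j k hjk h => hjk ?_⟩
  refine (hinf.natEmbedding _).injective (Subtype.ext ?_)
  rw [← hγg j, ← hγg k]
  exact Germ.coe_eq.2 h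

end

/-- Theorem 1: let `f` be transcendental meromorphic on `ℂ` with finitely many poles.
Then `ż = f(z)` has infinitely many pairwise disjoint trajectories, each tending to
infinity in finite increasing time. -/
theorem stmt16 (f : ℂ → ℂ) (hf : MeromorphicOn f Set.univ)
    (hpoles : {w : ℂ | ¬ AnalyticAt ℂ f w}.Finite)
    (htrans : ¬ ∃ p q : Polynomial ℂ, q ≠ 0 ∧
      ∀ w : ℂ, AnalyticAt ℂ f w → f w * q.eval w = p.eval w) :
    ∃ (γ : ℕ → ℝ → ℂ) (α β : ℕ → ℝ),
      (∀ k, α k < β k) ∧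
      (∀ k, ∀ t ∈ Set.Ioo (α k) (β k), HasDerivAt (γ k) (f (γ k t)) t) ∧
      (∀ k, Filter.Tendsto (fun t => ‖γ k t‖) (nhdsWithin (β k) (Set.Iio (β k)))
        Filter.atTop) ∧
      (∀ j k, j ≠ k → ∀ s ∈ Set.Ioo (α j) (β j), ∀ t ∈ Set.Ioo (α k) (β k),
        γ j s ≠ γ k t) := by
  obtain ⟨C, hC⟩ := hpoles.isBounded.exists_norm_le
  have hfd : DifferentiableOn ℂ f {z | max C 1 < ‖z‖} := by
    intro z hz
    have hz' : C < ‖z‖ := (le_max_left _ _).trans_lt hz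
    have : AnalyticAt ℂ f z := by
      by_contra h
      exact hz'.not_ge (hC z h)
    exact this.differentiableAt.differentiableWithinAt
  have hR : 1 ≤ max C 1 := le_max_right _ _
  obtain ⟨γ, hγ, hlim, hne⟩ := exists_infinite_blowup_family hR hfd fun D m =>
    exists_large_of_transcendental hf hpoles htrans (max C 1 + 2) D m (by linarith)
  choose a ha hγ using hγ
  refine ⟨γ, fun k => -a k, fun _ => 0, fun k => neg_lt_zero.2 (ha k),
    fun k t ht => (hγ k t ht).2, hlim, fun j k hjk s hs t ht => ?_⟩
  exact ne_of_blowup (isOpen_lt continuous_const continuous_norm) hfd (hγ j) (hγ k) (hlim j)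
    (hlim k) (hne j k hjk) hs ht
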